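/- Operational-separation achievability for the DM MABRC: Let a DM MABRC with correlated sources (S1,S2), relay side information W3 and destination side information W be given, and let κ > 0. Suppose there exist finite auxiliary alphabets V1, V2 and a joint distribution of the form p(s1,s2,w3,w)·p(v1)·p(x1|v1)·p(v2)·p(x2|v2)·p(x3|v1,v2), with (Y,Y3) generated from (X1,X2,X3) by the channel transition law, such that H(S1|S2,W3) < κ·I(X1;Y3|X2,V1,X3), H(S2|S1,W3) < κ·I(X2;Y3|X1,V2,X3), H(S1,S2|W3) < κ·I(X1,X2;Y3|V1,V2,X3), H(S1|S2,W) < κ·I(X1,X3;Y|X2,V2), H(S2|S1,W) < κ·I(X2,X3;Y|X1,V1), and H(S1,S2|W) < κ·I(X1,X2,X3;Y). Then the source-channel rate κ is achievable for the DM MABRC (i.e., both the relay and the destination reconstruct (S1^m,S2^m) with vanishing error probability). -/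

import Mathlib

open scoped BigOperators
open Finset

noncomputable section
open scoped Classical

namespace Paper

def pr {Ω A : Type*} [Fintype Ω] (μ : Ω → ℝ) (X : Ω → A) (a : A) : ℝ :=
  ∑ ω, if X ω = a then μ ω else 0

def Hent {Ω A : Type*} [Fintype Ω] [Fintype A] (μ : Ω → ℝ) (X : Ω → A) : ℝ :=
  - ∑ a, pr μ X a * Real.logb 2 (pr μ X a)

def condEnt {Ω A B : Type*} [Fintype Ω] [Fintype A] [Fintype B]
    (μ : Ω → ℝ) (X : Ω → A) (Y : Ω → B) : ℝ :=
  Hent μ (fun ω => (X ω, Y ω)) - Hent μ Y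

def mutInfo {Ω A B : Type*} [Fintype Ω] [Fintype A] [Fintype B]
    (μ : Ω → ℝ) (X : Ω → A) (Y : Ω → B) : ℝ :=
  Hent μ X + Hent μ Y - Hent μ (fun ω => (X ω, Y ω))

def condMutInfo {Ω A B C : Type*} [Fintype Ω] [Fintype A] [Fintype B] [Fintype C]
    (μ : Ω → ℝ) (X : Ω → A) (Y : Ω → B) (Z : Ω → C) : ℝ :=
  condEnt μ X Z - condEnt μ X (fun ω => (Y ω, Z ω))

structure SourcePMF (S : Type) [Fintype S] where
  q : S → ℝ
  nonneg : ∀ s, 0 ≤ q s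
  sum_one : ∑ s, q s = 1

/-- A discrete memoryless multiple-access (broadcast) relay channel. -/
structure DMMARC (X1 X2 X3 Y Y3 : Type) [Fintype X1] [Fintype X2] [Fintype X3]
    [Fintype Y] [Fintype Y3] where
  P : X1 → X2 → X3 → Y → Y3 → ℝ
  nonneg : ∀ x1 x2 x3 y y3, 0 ≤ P x1 x2 x3 y y3
  sum_one : ∀ x1 x2 x3, ∑ y : Y, ∑ y3 : Y3, P x1 x2 x3 y y3 = 1

/-- An (m,n) source-channel code for the MABRC: two encoders, a causal relay
encoding function, a destination decoder and a relay decoder. -/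
structure MABRCCode (S1 S2 W W3 X1 X2 X3 Y Y3 : Type) (m n : ℕ) where
  f1 : (Fin m → S1) → Fin n → X1
  f2 : (Fin m → S2) → Fin n → X2
  f3 : (k : Fin n) → (Fin k.val → Y3) → (Fin m → W3) → X3
  g : (Fin n → Y) → (Fin m → W) → (Fin m → S1) × (Fin m → S2)
  g3 : (Fin n → Y3) → (Fin m → W3) → (Fin m → S1) × (Fin m → S2)

variable {S1 S2 W W3 X1 X2 X3 Y Y3 : Type} {m n : ℕ}

/-- The relay channel input at time `k` (causal function of past relay outputs and `W3^m`). -/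
def relayIn (c : MABRCCode S1 S2 W W3 X1 X2 X3 Y Y3 m n)
    (y3 : Fin n → Y3) (w3 : Fin m → W3) (k : Fin n) : X3 :=
  c.f3 k (fun j => y3 ⟨j.val, j.isLt.trans k.isLt⟩) w3

section
variable [Fintype S1] [Fintype S2] [Fintype W] [Fintype W3]
  [Fintype X1] [Fintype X2] [Fintype X3] [Fintype Y] [Fintype Y3]

/-- Joint law on (source sequences, destination outputs, relay outputs)
induced by the i.i.d. source, the encoders, the causal relay function and the
memoryless channel. -/
def mabrcLaw (src : SourcePMF (S1 × S2 × W × W3)) (ch : DMMARC X1 X2 X3 Y Y3)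
    (c : MABRCCode S1 S2 W W3 X1 X2 X3 Y Y3 m n) :
    ((Fin m → S1 × S2 × W × W3) × (Fin n → Y) × (Fin n → Y3)) → ℝ :=
  fun ω => (∏ i, src.q (ω.1 i)) *
    ∏ k, ch.P (c.f1 (fun i => (ω.1 i).1) k) (c.f2 (fun i => (ω.1 i).2.1) k)
      (relayIn c ω.2.2 (fun i => (ω.1 i).2.2.2) k) (ω.2.1 k) (ω.2.2 k)

/-- Error probability of a MABRC source-channel code: an error occurs if either
the destination or the relay fails to reconstruct both source sequences. -/
def mabrcErr (src : SourcePMF (S1 × S2 × W × W3)) (ch : DMMARC X1 X2 X3 Y Y3)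
    (c : MABRCCode S1 S2 W W3 X1 X2 X3 Y Y3 m n) : ℝ :=
  ∑ ω : (Fin m → S1 × S2 × W × W3) × (Fin n → Y) × (Fin n → Y3),
    if c.g ω.2.1 (fun i => (ω.1 i).2.2.1) ≠ (fun i => (ω.1 i).1, fun i => (ω.1 i).2.1)
        ∨ c.g3 ω.2.2 (fun i => (ω.1 i).2.2.2) ≠ (fun i => (ω.1 i).1, fun i => (ω.1 i).2.1)
    then mabrcLaw src ch c ω else 0

/-- Achievability of the source-channel rate `κ` for the DM MABRC. -/
def mabrcAchievable (src : SourcePMF (S1 × S2 × W × W3)) (ch : DMMARC X1 X2 X3 Y Y3)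
    (κ : ℝ) : Prop :=
  ∀ ε : ℝ, 0 < ε → ∃ m0 n0 : ℕ, ∀ m n : ℕ, m0 < m → n0 < n → (n : ℝ) / m = κ →
    ∃ c : MABRCCode S1 S2 W W3 X1 X2 X3 Y Y3 m n, mabrcErr src ch c < ε

end

section OperationalSeparation

variable {S1 S2 W W3 V1 V2 X1 X2 X3 Y Y3 : Type}
  [Fintype S1] [Fintype S2] [Fintype W] [Fintype W3] [Fintype V1] [Fintype V2]
  [Fintype X1] [Fintype X2] [Fintype X3] [Fintype Y] [Fintype Y3]

/-- The joint single-letter law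
`p(s1,s2,w3,w)·p(v1)·p(x1|v1)·p(v2)·p(x2|v2)·p(x3|v1,v2)·p(y,y3|x1,x2,x3)`.
Coordinates: `z.1 = (s1,s2,w,w3)`, then `v1, v2, x1, x2, x3, y, y3`. -/
def opSepLaw (src : SourcePMF (S1 × S2 × W × W3)) (ch : DMMARC X1 X2 X3 Y Y3)
    (pV1 : V1 → ℝ) (pX1 : V1 → X1 → ℝ) (pV2 : V2 → ℝ) (pX2 : V2 → X2 → ℝ)
    (pX3 : V1 → V2 → X3 → ℝ) :
    ((S1 × S2 × W × W3) × V1 × V2 × X1 × X2 × X3 × Y × Y3) → ℝ :=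
  fun z => src.q z.1 * pV1 z.2.1 * pX1 z.2.1 z.2.2.2.1 * pV2 z.2.2.1
    * pX2 z.2.2.1 z.2.2.2.2.1 * pX3 z.2.1 z.2.2.1 z.2.2.2.2.2.1
    * ch.P z.2.2.2.1 z.2.2.2.2.1 z.2.2.2.2.2.1 z.2.2.2.2.2.2.1 z.2.2.2.2.2.2.2

/-! ### Weighted sums over finite types -/

section WeightedSums

variable {A B J I : Type*} [Fintype A] [Fintype B] [Fintype J] [Fintype I]

/-- The expectation of `f` under the weights `p`. -/
def wsum (p f : A → ℝ) : ℝ := ∑ a, p a * f a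

/-- The real-valued indicator of a proposition. -/
def ind (p : Prop) : ℝ := if p then 1 else 0

lemma ind_of_true {p : Prop} (h : p) : ind p = 1 := if_pos h

lemma ind_of_false {p : Prop} (h : ¬p) : ind p = 0 := if_neg h

lemma ind_nonneg (p : Prop) : 0 ≤ ind p := by
  unfold ind
  split_ifs <;> norm_num

lemma ind_le_one (p : Prop) : ind p ≤ 1 := by
  unfold ind
  split_ifs <;> norm_num

lemma ind_mono {p q : Prop} (h : p → q) : ind p ≤ ind q := by
  by_cases hp : p
  · rw [ind_of_true hp, ind_of_true (h hp)]
  · rw [ind_of_false hp]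
    exact ind_nonneg q

/-- `p` is a probability mass function. -/
structure IsPmf (p : A → ℝ) : Prop where
  nonneg : ∀ a, 0 ≤ p a
  sum_one : ∑ a, p a = 1

/-- The product weights on a finite power. -/
def piPmf (p : I → A → ℝ) (f : I → A) : ℝ := ∏ i, p i (f i)

lemma wsum_const {p : A → ℝ} (hp : IsPmf p) (c : ℝ) : wsum p (fun _ => c) = c := by
  simp [wsum, ← Finset.sum_mul, hp.sum_one]

lemma wsum_comm (p : A → ℝ) (q : B → ℝ) (f : A → B → ℝ) :
    wsum p (fun a => wsum q (fun b => f a b)) = wsum q (fun b => wsum p (fun a => f a b)) := by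
  simp only [wsum, Finset.mul_sum]
  rw [Finset.sum_comm]
  refine Finset.sum_congr rfl fun b _ => Finset.sum_congr rfl fun a _ => by ring

lemma wsum_mono {p : A → ℝ} (hp : ∀ a, 0 ≤ p a) {f g : A → ℝ}
    (h : ∀ a, 0 < p a → f a ≤ g a) : wsum p f ≤ wsum p g := by
  refine Finset.sum_le_sum fun a _ => ?_
  rcases (hp a).eq_or_lt with h0 | h0
  · simp [← h0]
  · exact mul_le_mul_of_nonneg_left (h a h0) h0.le

lemma wsum_nonneg {p : A → ℝ} (hp : ∀ a, 0 ≤ p a) {f : A → ℝ} (h : ∀ a, 0 ≤ f a) :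
    0 ≤ wsum p f :=
  Finset.sum_nonneg fun a _ => mul_nonneg (hp a) (h a)

lemma wsum_add (p f g : A → ℝ) :
    wsum p (fun a => f a + g a) = wsum p f + wsum p g := by
  simp [wsum, mul_add, Finset.sum_add_distrib]

lemma wsum_sub (p f g : A → ℝ) :
    wsum p (fun a => f a - g a) = wsum p f - wsum p g := by
  simp [wsum, mul_sub, Finset.sum_sub_distrib]

lemma wsum_sum (p : A → ℝ) (f : B → A → ℝ) :
    wsum p (fun a => ∑ b, f b a) = ∑ b, wsum p (f b) := by
  simp only [wsum, Finset.mul_sum]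
  rw [Finset.sum_comm]

lemma wsum_mul_left (p f : A → ℝ) (c : ℝ) :
    wsum p (fun a => c * f a) = c * wsum p f := by
  simp only [wsum, Finset.mul_sum]
  refine Finset.sum_congr rfl fun a _ => by ring

lemma exists_le_of_wsum_le {p : A → ℝ} (hp : IsPmf p) {f : A → ℝ} {b : ℝ}
    (h : wsum p f ≤ b) : ∃ a, f a ≤ b := by
  by_contra! hcon
  have hpos : ∃ a, 0 < p a := by
    by_contra! hle
    have : ∑ a, p a ≤ 0 := Finset.sum_nonpos fun a _ => hle a
    rw [hp.sum_one] at this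
    linarith
  obtain ⟨a, ha⟩ := hpos
  have : wsum p (fun _ => b) < wsum p f :=
    Finset.sum_lt_sum (fun a _ => mul_le_mul_of_nonneg_left (hcon a).le (hp.nonneg a))
      ⟨a, Finset.mem_univ a, mul_lt_mul_of_pos_left (hcon a) ha⟩
  rw [wsum_const hp] at this
  linarith

lemma wsum_prod_weights (p : A → ℝ) (k : A → B → ℝ) (f : A × B → ℝ) :
    wsum (fun z : A × B => p z.1 * k z.1 z.2) f =
      wsum p (fun a => wsum (k a) fun b => f (a, b)) := by
  simp only [wsum, Fintype.sum_prod_type, Finset.mul_sum, mul_assoc]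

variable [DecidableEq I] [DecidableEq J]

lemma wsum_piPmf_prod (p g : I → A → ℝ) :
    wsum (piPmf p) (fun f => ∏ i, g i (f i)) = ∏ i, wsum (p i) (g i) := by
  simp only [wsum, piPmf, ← Finset.prod_mul_distrib]
  rw [Fintype.prod_sum]

lemma isPmf_piPmf {p : I → A → ℝ} (hp : ∀ i, IsPmf (p i)) : IsPmf (piPmf p) where
  nonneg f := Finset.prod_nonneg fun i _ => (hp i).nonneg _
  sum_one := by
    simp only [piPmf]
    rw [← Fintype.prod_sum]
    simp [(hp _).sum_one]

/-- Marginalization of product weights along an injection of the index set. -/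
lemma wsum_piPmf_comp {p : I → A → ℝ} (hp : ∀ i, IsPmf (p i)) {e : J → I}
    (he : Function.Injective e) (F : (J → A) → ℝ) :
    wsum (piPmf p) (fun f => F (fun j => f (e j))) = wsum (piPmf fun j => p (e j)) F := by
  have key : ∀ g : J → A, wsum (piPmf p) (fun f => if (fun j => f (e j)) = g then 1 else 0)
      = piPmf (fun j => p (e j)) g := by
    intro g
    have h1 : ∀ f : I → A, (if (fun j => f (e j)) = g then (1 : ℝ) else 0)
        = ∏ i, if ∀ j, e j = i → f i = g j then (1 : ℝ) else 0 := by
      intro f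
      rw [Finset.prod_ite_zero]
      simp only [Finset.prod_const_one]
      refine if_congr ?_ rfl rfl
      constructor
      · rintro h i - j rfl
        exact congrFun h j
      · intro h
        funext j
        exact h (e j) (Finset.mem_univ _) j rfl
    simp only [h1]
    rw [wsum_piPmf_prod p (fun i a => if ∀ j, e j = i → a = g j then (1 : ℝ) else 0)]
    symm
    unfold piPmf
    refine Fintype.prod_of_injective e he _ _ ?_ ?_
    · intro i hi
      have : ∀ a : A, (∀ j, e j = i → a = g j) := fun a j hj => absurd ⟨j, hj⟩ hi
      refine Eq.trans (congrArg _ (funext fun a => if_pos (this a))) (wsum_const (hp i) 1)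
    · intro j
      have : ∀ a : A, (∀ j', e j' = e j → a = g j') ↔ a = g j :=
        fun a => ⟨fun h => h j rfl, fun h j' hj' => by rw [he hj']; exact h⟩
      simp [wsum, this]
  have h2 : ∀ f : I → A, F (fun j => f (e j))
      = ∑ g, F g * (if (fun j => f (e j)) = g then (1 : ℝ) else 0) := by
    intro f
    simp
  simp only [h2]
  rw [wsum_sum]
  simp only [wsum_mul_left, key]
  exact Finset.sum_congr rfl fun g _ => mul_comm _ _

lemma wsum_piPmf_single {p : I → A → ℝ} (hp : ∀ i, IsPmf (p i)) (i : I) (F : A → ℝ) :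
    wsum (piPmf p) (fun f => F (f i)) = wsum (p i) F := by
  rw [wsum_piPmf_comp hp (e := fun _ : Unit => i) (fun _ _ _ => rfl) (fun g => F (g ()))]
  exact Fintype.sum_equiv (Equiv.funUnique Unit A) _ _ fun g => by simp [piPmf]

lemma wsum_piPmf_pair {p : I → A → ℝ} (hp : ∀ i, IsPmf (p i)) {i j : I} (hij : i ≠ j)
    (F : A → A → ℝ) :
    wsum (piPmf p) (fun f => F (f i) (f j)) = wsum (p i) fun a => wsum (p j) fun b => F a b := by
  have he : Function.Injective ![i, j] := by
    intro a b h
    fin_cases a <;> fin_cases b <;> simp_all [eq_comm]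
  have h := wsum_piPmf_comp hp he (fun g => F (g 0) (g 1))
  simp only [Matrix.cons_val_zero, Matrix.cons_val_one] at h
  rw [h, ← wsum_prod_weights (p i) (fun _ => p j) (fun z => F z.1 z.2)]
  exact Fintype.sum_equiv (finTwoArrowEquiv A) _ _ fun g => by
    simp [piPmf, Fin.prod_univ_two, finTwoArrowEquiv]

end WeightedSums

/-! ### Threshold decoding of random codes -/

section ThresholdDecoding

/-- The decoder that returns a message all of whose scores exceed `θ`, if there is one. -/
def thresholdDecode {M ι : Type*} (x0 : M) (θ : ℝ) (score : ι → M → ℝ) : M :=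
  if h : ∃ x, ∀ j, θ < score j x then h.choose else x0

lemma thresholdDecode_ne_le {M ι : Type*} [Fintype M] [Fintype ι] {x0 : M} {θ : ℝ}
    {score : ι → M → ℝ} {rel : ι → M → M → Prop}
    (hrel : ∀ x x', x' ≠ x → ∃ j, rel j x x') (x : M) :
    ind (thresholdDecode x0 θ score ≠ x)
      ≤ ∑ j, ((if score j x ≤ θ then (1 : ℝ) else 0)
        + ∑ x', if rel j x x' then (if θ < score j x' then (1 : ℝ) else 0) else 0) := by
  have hin : ∀ j x', (0 : ℝ)
      ≤ if rel j x x' then (if θ < score j x' then (1 : ℝ) else 0) else 0 := by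
    intro j x'
    split_ifs <;> norm_num
  have hterm : ∀ j, (0 : ℝ) ≤ (if score j x ≤ θ then (1 : ℝ) else 0)
        + ∑ x', if rel j x x' then (if θ < score j x' then (1 : ℝ) else 0) else 0 := by
    intro j
    refine add_nonneg (by split_ifs <;> norm_num) (Finset.sum_nonneg fun x' _ => hin j x')
  by_cases hne : thresholdDecode x0 θ score ≠ x
  swap
  · rw [ind_of_false hne]
    exact Finset.sum_nonneg fun j _ => hterm j
  rw [ind_of_true hne]
  suffices h : ∃ j, 1 ≤ (if score j x ≤ θ then (1 : ℝ) else 0)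
        + ∑ x', if rel j x x' then (if θ < score j x' then (1 : ℝ) else 0) else 0 by
    obtain ⟨j, hj⟩ := h
    exact hj.trans (Finset.single_le_sum (fun j _ => hterm j) (Finset.mem_univ j))
  by_cases hx : ∀ j, θ < score j x
  · have hex : ∃ x, ∀ j, θ < score j x := ⟨x, hx⟩
    obtain ⟨j, hj⟩ := hrel x _ hne
    have hdec : θ < score j (thresholdDecode x0 θ score) := by
      have := hex.choose_spec j
      rwa [thresholdDecode, dif_pos hex]
    refine ⟨j, ?_⟩
    have h1 := Finset.single_le_sum (fun x' _ => hin j x')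
      (Finset.mem_univ (thresholdDecode x0 θ score))
    rw [if_pos hj, if_pos hdec] at h1
    have h2 : (0 : ℝ) ≤ (if score j x ≤ θ then (1 : ℝ) else 0) := by split_ifs <;> norm_num
    linarith
  · push Not at hx
    obtain ⟨j, hj⟩ := hx
    refine ⟨j, ?_⟩
    rw [if_pos hj]
    linarith [Finset.sum_nonneg (s := Finset.univ) fun x' _ => hin j x']

variable {L U O M ι : Type*} [Fintype L] [Fintype U] [Fintype O] [Fintype M] [Fintype ι]

/-- Expected error probability of threshold decoding for a fixed message `x`, when the code letters
are drawn independently from `μ` and sent over the memoryless channel `K`. -/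
lemma wsum_thresholdDecode_le {n : ℕ} {μ : L → ℝ} (hμ : IsPmf μ) {T : M → L → U}
    {K : U → O → ℝ} (hK : ∀ u, IsPmf (K u)) {pU : U → ℝ}
    (hT : ∀ x (F : U → ℝ), wsum μ (fun c => F (T x c)) = wsum pU F)
    {r : ι → U → O → ℝ} (hr : ∀ j u o, 0 ≤ r j u o)
    (hrpos : ∀ j u o, 0 < pU u → 0 < K u o → 0 < r j u o)
    {rel : ι → M → M → Prop} (hrel : ∀ x x', x' ≠ x → ∃ j, rel j x x')
    (hwrong : ∀ j x x', rel j x x' →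
      wsum μ (fun c => wsum (K (T x c)) fun o => r j (T x' c) o) ≤ 1)
    {a : ι → M → ℝ} (ha : ∀ j x, 0 ≤ a j x) (x0 x : M) (hax : ∀ j, 0 < a j x)
    {θ : ℝ} (hθ : 0 < θ) {t : ι → ℝ} (ht : ∀ j, 0 < t j) :
    wsum (piPmf fun _ : Fin n => μ) (fun c => wsum (piPmf fun k => K (T x (c k))) fun o =>
      ind (thresholdDecode x0 θ (fun j x' => a j x' * ∏ k, r j (T x' (c k)) (o k)) ≠ x))
      ≤ ∑ j, (θ ^ t j * (a j x) ^ (-t j)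
            * (wsum pU fun u => wsum (K u) fun o => (r j u o) ^ (-t j)) ^ n
          + θ⁻¹ * ∑ x', ind (rel j x x') * a j x') := by
  have hμn : ∀ c, 0 ≤ piPmf (fun _ : Fin n => μ) c := (isPmf_piPmf fun _ => hμ).nonneg
  have hKn : ∀ (c : Fin n → L) o, 0 ≤ piPmf (fun k => K (T x (c k))) o :=
    fun c => (isPmf_piPmf fun k => hK _).nonneg
  have hprod : ∀ (x' : M) (F : U → O → ℝ),
      wsum (piPmf fun _ : Fin n => μ) (fun c => wsum (piPmf fun k => K (T x (c k))) fun o =>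
        ∏ k, F (T x' (c k)) (o k))
      = (wsum μ fun c => wsum (K (T x c)) fun o => F (T x' c) o) ^ n := by
    intro x' F
    simp only [fun c : Fin n → L => wsum_piPmf_prod (fun k => K (T x (c k)))
      (fun k => F (T x' (c k)))]
    rw [wsum_piPmf_prod (fun _ : Fin n => μ)
      (fun _ c => wsum (K (T x c)) fun o => F (T x' c) o)]
    simp
  have hpos : ∀ u c, T x c = u → 0 < μ c → 0 < pU u := by
    intro u c hc h0
    have h1 := hT x (fun u' => if u' = u then 1 else 0)
    have h2 : wsum pU (fun u' => if u' = u then 1 else 0) = pU u := by simp [wsum]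
    rw [h2] at h1
    rw [← h1]
    have h3 : μ c ≤ wsum μ fun c => if T x c = u then 1 else 0 := by
      have := Finset.single_le_sum (s := Finset.univ)
        (f := fun c => μ c * if T x c = u then (1 : ℝ) else 0)
        (fun c _ => mul_nonneg (hμ.nonneg c) (by split_ifs <;> norm_num)) (Finset.mem_univ c)
      simpa [hc, wsum] using this
    exact h0.trans_le h3
  refine le_trans (wsum_mono hμn fun c _ => wsum_mono (hKn c) fun o _ =>
    thresholdDecode_ne_le hrel x) ?_
  simp only [wsum_sum, wsum_add]
  refine Finset.sum_le_sum fun j _ => add_le_add ?_ ?_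
  · have hb : (wsum pU fun u => wsum (K u) fun o => (r j u o) ^ (-t j)) ^ n
        = wsum (piPmf fun _ : Fin n => μ) (fun c => wsum (piPmf fun k => K (T x (c k))) fun o =>
        ∏ k, (r j (T x (c k)) (o k)) ^ (-t j)) := by
      rw [hprod x fun u o => (r j u o) ^ (-t j),
        hT x fun u => wsum (K u) fun o => (r j u o) ^ (-t j)]
    rw [hb, ← wsum_mul_left]
    refine wsum_mono hμn fun c hc => ?_
    rw [← wsum_mul_left]
    refine wsum_mono (hKn c) fun o ho => ?_
    have hck : ∀ k, 0 < μ (c k) := fun k => (hμ.nonneg _).lt_of_ne fun h =>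
      hc.ne' (Finset.prod_eq_zero (Finset.mem_univ k) h.symm)
    have hok : ∀ k, 0 < K (T x (c k)) (o k) := fun k => ((hK _).nonneg _).lt_of_ne fun h =>
      ho.ne' (Finset.prod_eq_zero (Finset.mem_univ k) h.symm)
    have hrk : ∀ k, 0 < r j (T x (c k)) (o k) := fun k =>
      hrpos j _ _ (hpos _ (c k) rfl (hck k)) (hok k)
    have hR : 0 < ∏ k, r j (T x (c k)) (o k) := Finset.prod_pos fun k _ => hrk k
    rw [Real.finsetProd_rpow _ _ fun k _ => (hrk k).le, mul_assoc,
      ← Real.mul_rpow (hax j).le hR.le]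
    have hs := mul_pos (hax j) hR
    split_ifs with hle
    · rw [Real.rpow_neg hs.le, ← div_eq_mul_inv, one_le_div (Real.rpow_pos_of_pos hs _)]
      exact Real.rpow_le_rpow hs.le hle (ht j).le
    · positivity
  · rw [Finset.mul_sum]
    refine Finset.sum_le_sum fun x' _ => ?_
    by_cases hj : rel j x x'
    swap
    · simp [hj, wsum, ind]
    simp only [if_pos hj, ind_of_true hj, one_mul]
    have hle : wsum (piPmf fun _ : Fin n => μ)
          (fun c => wsum (piPmf fun k => K (T x (c k))) fun o =>
            if θ < a j x' * ∏ k, r j (T x' (c k)) (o k) then 1 else 0)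
        ≤ wsum (piPmf fun _ : Fin n => μ)
          (fun c => wsum (piPmf fun k => K (T x (c k))) fun o =>
            (θ⁻¹ * a j x') * ∏ k, r j (T x' (c k)) (o k)) := by
      refine wsum_mono hμn fun c _ => wsum_mono (hKn c) fun o _ => ?_
      have hR : 0 ≤ ∏ k, r j (T x' (c k)) (o k) := Finset.prod_nonneg fun k _ => hr j _ _
      have := ha j x'
      split_ifs with hlt
      · rw [mul_assoc, ← div_eq_inv_mul, one_le_div hθ]
        exact hlt.le
      · positivity
    refine hle.trans ?_
    simp only [wsum_mul_left]
    rw [hprod x' (r j)]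
    have h0 : 0 ≤ wsum μ fun c => wsum (K (T x c)) fun o => r j (T x' c) o :=
      wsum_nonneg hμ.nonneg fun c => wsum_nonneg (hK _).nonneg fun o => hr j _ _
    have h1 := pow_le_one₀ (n := n) h0 (hwrong j x x' hj)
    exact mul_le_of_le_one_right (mul_nonneg (inv_nonneg.2 hθ.le) (ha j x')) h1

end ThresholdDecoding

/-! ### Joint source-channel threshold decoding of a pair of messages -/

section PairDecoding

/-- The three ways in which a pair can differ from another one: in the first component only, in
the second component only, or in both. -/
def differs {M1 M2 : Type*} : Fin 3 → M1 × M2 → M1 × M2 → Prop :=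
  ![fun x x' => x'.1 ≠ x.1 ∧ x'.2 = x.2, fun x x' => x'.1 = x.1 ∧ x'.2 ≠ x.2,
    fun x x' => x'.1 ≠ x.1 ∧ x'.2 ≠ x.2]

lemma exists_differs {M1 M2 : Type*} (x x' : M1 × M2) (h : x' ≠ x) : ∃ j, differs j x x' := by
  by_cases h1 : x'.1 = x.1
  · exact ⟨1, h1, fun h2 => h (Prod.ext h1 h2)⟩
  · by_cases h2 : x'.2 = x.2
    · exact ⟨0, h1, h2⟩
    · exact ⟨2, h1, h2⟩

lemma sum_pi_prod_le_one {I A : Type*} [Fintype I] [DecidableEq I] [Fintype A] {f : I → A → ℝ}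
    (hf : ∀ i a, 0 ≤ f i a) (hs : ∀ i, ∑ a, f i a ≤ 1) : ∑ b : I → A, ∏ i, f i (b i) ≤ 1 := by
  rw [← Fintype.prod_sum]
  exact Finset.prod_le_one (fun i _ => Finset.sum_nonneg fun a _ => hf i a) fun i _ => hs i

variable {A1 A2 D S L U O Ctx : Type*} [Fintype A1] [Fintype A2] [Fintype S]
  [Fintype L] [Fintype U] [Fintype O]

lemma sum_differs_le_one {k : ℕ} {a : Fin 3 → A1 → A2 → D → ℝ}
    (ha : ∀ j s1 s2 w, 0 ≤ a j s1 s2 w)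
    (ha0 : ∀ s2 w, ∑ s1, a 0 s1 s2 w ≤ 1) (ha1 : ∀ s1 w, ∑ s2, a 1 s1 s2 w ≤ 1)
    (ha2 : ∀ w, ∑ s : A1 × A2, a 2 s.1 s.2 w ≤ 1)
    (j : Fin 3) (x : (Fin k → A1) × (Fin k → A2)) (w : Fin k → D) :
    (∑ x' : (Fin k → A1) × (Fin k → A2),
      ind (differs j x x') * ∏ i, a j (x'.1 i) (x'.2 i) (w i)) ≤ 1 := by
  have hP : ∀ j (x' : (Fin k → A1) × (Fin k → A2)), 0 ≤ ∏ i, a j (x'.1 i) (x'.2 i) (w i) :=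
    fun j x' => Finset.prod_nonneg fun i _ => ha _ _ _ _
  fin_cases j
  · refine le_trans ?_ (sum_pi_prod_le_one (f := fun i s1 => a 0 s1 (x.2 i) (w i))
      (fun i s1 => ha _ _ _ _) fun i => ha0 _ _)
    rw [Fintype.sum_prod_type]
    refine Finset.sum_le_sum fun b1 _ => ?_
    rw [Finset.sum_eq_single x.2]
    · exact mul_le_of_le_one_left (hP 0 (b1, x.2)) (ind_le_one _)
    · intro b2 _ hb
      exact mul_eq_zero_of_left (ind_of_false fun h => hb h.2) _
    · simp
  · refine le_trans ?_ (sum_pi_prod_le_one (f := fun i s2 => a 1 (x.1 i) s2 (w i))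
      (fun i s2 => ha _ _ _ _) fun i => ha1 _ _)
    rw [Fintype.sum_prod_type, Finset.sum_comm]
    refine Finset.sum_le_sum fun b2 _ => ?_
    rw [Finset.sum_eq_single x.1]
    · exact mul_le_of_le_one_left (hP 1 (x.1, b2)) (ind_le_one _)
    · intro b1 _ hb
      exact mul_eq_zero_of_left (ind_of_false fun h => hb h.1) _
    · simp
  · refine le_trans ?_ (sum_pi_prod_le_one (f := fun i (s : A1 × A2) => a 2 s.1 s.2 (w i))
      (fun i s => ha _ _ _ _) fun i => ha2 _)
    rw [← (Equiv.arrowProdEquivProdArrow (Fin k) (fun _ => A1) (fun _ => A2)).symm.sum_comp]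
    refine Finset.sum_le_sum fun b _ => ?_
    exact mul_le_of_le_one_left (hP 2 b) (ind_le_one _)

/-- The threshold decoder with scores `source probability × likelihood ratio`. -/
def jointDecode {k n : ℕ} (x0 : (Fin k → A1) × (Fin k → A2)) (θ : ℝ)
    (a : Fin 3 → A1 → A2 → D → ℝ) (r : Fin 3 → U → O → ℝ)
    (T : (Fin k → A1) × (Fin k → A2) → Fin n → U) (o : Fin n → O) (w : Fin k → D) :
    (Fin k → A1) × (Fin k → A2) :=
  thresholdDecode x0 θ fun j x =>
    (∏ i, a j (x.1 i) (x.2 i) (w i)) * ∏ l, r j (T x l) (o l)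

/-- Expected error probability of joint source-channel threshold decoding of a block of a
memoryless source, averaged over the random code. -/
lemma wsum_jointDecode_le {m k n : ℕ} {μ : L → ℝ} (hμ : IsPmf μ)
    {T : Ctx → (Fin k → A1) × (Fin k → A2) → L → U}
    {K : U → O → ℝ} (hK : ∀ u, IsPmf (K u)) {pU : U → ℝ}
    (hT : ∀ y x (F : U → ℝ), wsum μ (fun c => F (T y x c)) = wsum pU F)
    {r : Fin 3 → U → O → ℝ} (hr : ∀ j u o, 0 ≤ r j u o)
    (hrpos : ∀ j u o, 0 < pU u → 0 < K u o → 0 < r j u o)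
    (hwrong : ∀ j y x x', differs j x x' →
      wsum μ (fun c => wsum (K (T y x c)) fun o => r j (T y x' c) o) ≤ 1)
    {q : S → ℝ} (hq : IsPmf q) (p1 : S → A1) (p2 : S → A2) (pd : S → D)
    {a : Fin 3 → A1 → A2 → D → ℝ} (ha : ∀ j s1 s2 w, 0 ≤ a j s1 s2 w)
    (hapos : ∀ j s, 0 < q s → 0 < a j (p1 s) (p2 s) (pd s))
    (ha0 : ∀ s2 w, ∑ s1, a 0 s1 s2 w ≤ 1) (ha1 : ∀ s1 w, ∑ s2, a 1 s1 s2 w ≤ 1)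
    (ha2 : ∀ w, ∑ s : A1 × A2, a 2 s.1 s.2 w ≤ 1)
    (x0 : (Fin k → A1) × (Fin k → A2)) {σ : Fin k → Fin m} (hσ : Function.Injective σ)
    (ctx : (Fin m → S) → Ctx) {θ : ℝ} (hθ : 0 < θ) {t : Fin 3 → ℝ} (ht : ∀ j, 0 < t j) :
    wsum (piPmf fun _ : Fin n => μ) (fun c => wsum (piPmf fun _ : Fin m => q) fun s =>
      wsum (piPmf fun l => K (T (ctx s) (fun i => p1 (s (σ i)), fun i => p2 (s (σ i))) (c l)))
        fun o => ind (jointDecode x0 θ a r (fun x l => T (ctx s) x (c l)) o (fun i => pd (s (σ i)))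
          ≠ (fun i => p1 (s (σ i)), fun i => p2 (s (σ i)))))
      ≤ ∑ j, (θ ^ t j * (wsum q fun s => (a j (p1 s) (p2 s) (pd s)) ^ (-t j)) ^ k
            * (wsum pU fun u => wsum (K u) fun o => (r j u o) ^ (-t j)) ^ n + θ⁻¹) := by
  rw [wsum_comm]
  set β : Fin 3 → ℝ := fun j => wsum pU fun u => wsum (K u) fun o => (r j u o) ^ (-t j) with hβ
  have hqm : IsPmf (piPmf fun _ : Fin m => q) := isPmf_piPmf fun _ => hq
  have hstep : ∀ s : Fin m → S, 0 < piPmf (fun _ : Fin m => q) s →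
      wsum (piPmf fun _ : Fin n => μ) (fun c =>
        wsum (piPmf fun l => K (T (ctx s) (fun i => p1 (s (σ i)), fun i => p2 (s (σ i))) (c l)))
        fun o => ind (jointDecode x0 θ a r (fun x l => T (ctx s) x (c l)) o (fun i => pd (s (σ i)))
          ≠ (fun i => p1 (s (σ i)), fun i => p2 (s (σ i)))))
      ≤ ∑ j, (θ ^ t j * (β j ^ n
          * ∏ i, (a j (p1 (s (σ i))) (p2 (s (σ i))) (pd (s (σ i)))) ^ (-t j)) + θ⁻¹) := by
    intro s hs
    have hsi : ∀ i, 0 < q (s i) := fun i => (hq.nonneg _).lt_of_ne fun h =>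
      hs.ne' (Finset.prod_eq_zero (Finset.mem_univ i) h.symm)
    refine (wsum_thresholdDecode_le hμ hK (hT (ctx s)) hr hrpos exists_differs
      (fun j x x' => hwrong j (ctx s) x x')
      (a := fun j x => ∏ i, a j (x.1 i) (x.2 i) (pd (s (σ i))))
      (fun j x => Finset.prod_nonneg fun i _ => ha _ _ _ _) x0
      (fun i => p1 (s (σ i)), fun i => p2 (s (σ i)))
      (fun j => Finset.prod_pos fun i _ => hapos j _ (hsi _)) hθ ht).trans ?_
    refine Finset.sum_le_sum fun j _ => add_le_add (le_of_eq ?_) ?_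
    · rw [Real.finsetProd_rpow _ _ fun i _ => ha _ _ _ _]
      ring
    · exact mul_le_of_le_one_right (inv_nonneg.2 hθ.le)
        (sum_differs_le_one ha ha0 ha1 ha2 j _ _)
  refine (wsum_mono hqm.nonneg hstep).trans (le_of_eq ?_)
  rw [wsum_sum]
  refine Finset.sum_congr rfl fun j _ => ?_
  rw [wsum_add, wsum_const hqm, wsum_mul_left, wsum_mul_left,
    wsum_piPmf_comp (fun _ => hq) hσ
      (fun s => ∏ i, (a j (p1 (s i)) (p2 (s i)) (pd (s i))) ^ (-t j)),
    wsum_piPmf_prod (fun _ : Fin k => q) (fun _ s => (a j (p1 s) (p2 s) (pd s)) ^ (-t j))]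
  simp only [Finset.prod_const, Finset.card_univ, Fintype.card_fin]
  ring

end PairDecoding

/-! ### Entropies as expected logarithms -/

section Entropies

variable {Ω Ω' A B C : Type*} [Fintype Ω] [Fintype Ω']

/-- The conditional probability of `X = x` given `Y = y`. -/
def condPr (μ : Ω → ℝ) (X : Ω → A) (Y : Ω → B) (x : A) (y : B) : ℝ :=
  pr μ (fun ω => (X ω, Y ω)) (x, y) / pr μ Y y

/-- The exponential of the conditional information density of `X` and `Y` given `Z`. -/
def infoRatio (μ : Ω → ℝ) (X : Ω → A) (Y : Ω → B) (Z : Ω → C) (x : A) (y : B) (z : C) : ℝ :=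
  pr μ (fun ω => (X ω, Y ω, Z ω)) (x, y, z) * pr μ Z z
    / (pr μ (fun ω => (X ω, Z ω)) (x, z) * pr μ (fun ω => (Y ω, Z ω)) (y, z))

lemma pr_eq_wsum (μ : Ω → ℝ) (X : Ω → A) (a : A) :
    pr μ X a = wsum μ fun ω => ind (X ω = a) := by
  refine Finset.sum_congr rfl fun ω _ => ?_
  by_cases h : X ω = a <;> simp [h, ind]

lemma pr_nonneg {μ : Ω → ℝ} (hμ : ∀ ω, 0 ≤ μ ω) (X : Ω → A) (a : A) :
    0 ≤ pr μ X a := by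
  rw [pr_eq_wsum]
  exact wsum_nonneg hμ fun ω => ind_nonneg _

lemma pr_self_pos {μ : Ω → ℝ} (hμ : ∀ ω, 0 ≤ μ ω) (X : Ω → A) {ω : Ω} (h : 0 < μ ω) :
    0 < pr μ X (X ω) := by
  refine h.trans_le ?_
  rw [pr_eq_wsum]
  have := Finset.single_le_sum (s := Finset.univ) (f := fun ω' => μ ω' * ind (X ω' = X ω))
    (fun ω' _ => mul_nonneg (hμ ω') (ind_nonneg _)) (Finset.mem_univ ω)
  simpa [ind_of_true, wsum] using this

lemma condPr_nonneg {μ : Ω → ℝ} (hμ : ∀ ω, 0 ≤ μ ω) (X : Ω → A) (Y : Ω → B) (x : A) (y : B) :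
    0 ≤ condPr μ X Y x y :=
  div_nonneg (pr_nonneg hμ _ _) (pr_nonneg hμ _ _)

lemma condPr_pos {μ : Ω → ℝ} (hμ : ∀ ω, 0 ≤ μ ω) (X : Ω → A) (Y : Ω → B) {ω : Ω} (h : 0 < μ ω) :
    0 < condPr μ X Y (X ω) (Y ω) :=
  div_pos (pr_self_pos hμ (fun ω => (X ω, Y ω)) h) (pr_self_pos hμ Y h)

lemma infoRatio_nonneg {μ : Ω → ℝ} (hμ : ∀ ω, 0 ≤ μ ω) (X : Ω → A) (Y : Ω → B) (Z : Ω → C)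
    (x : A) (y : B) (z : C) : 0 ≤ infoRatio μ X Y Z x y z :=
  div_nonneg (mul_nonneg (pr_nonneg hμ _ _) (pr_nonneg hμ _ _))
    (mul_nonneg (pr_nonneg hμ _ _) (pr_nonneg hμ _ _))

lemma infoRatio_pos {μ : Ω → ℝ} (hμ : ∀ ω, 0 ≤ μ ω) (X : Ω → A) (Y : Ω → B) (Z : Ω → C)
    {ω : Ω} (h : 0 < μ ω) : 0 < infoRatio μ X Y Z (X ω) (Y ω) (Z ω) :=
  div_pos (mul_pos (pr_self_pos hμ (fun ω => (X ω, Y ω, Z ω)) h) (pr_self_pos hμ Z h))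
    (mul_pos (pr_self_pos hμ (fun ω => (X ω, Z ω)) h) (pr_self_pos hμ (fun ω => (Y ω, Z ω)) h))

lemma sum_pr_pair_left [Fintype A] (μ : Ω → ℝ) (X : Ω → A) (Y : Ω → B) (y : B) :
    ∑ x, pr μ (fun ω => (X ω, Y ω)) (x, y) = pr μ Y y := by
  simp only [pr_eq_wsum]
  rw [← wsum_sum]
  refine congrArg _ (funext fun ω => ?_)
  by_cases h : Y ω = y <;> simp [ind, h]

variable [Fintype A] [Fintype B] [Fintype C]

lemma wsum_pr (μ : Ω → ℝ) (X : Ω → A) (f : A → ℝ) :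
    wsum (pr μ X) f = wsum μ fun ω => f (X ω) := by
  have h : ∀ ω, f (X ω) = ∑ a, ind (X ω = a) * f a := fun ω => by simp [ind]
  simp only [h]
  rw [wsum_sum]
  refine Finset.sum_congr rfl fun a _ => ?_
  rw [pr_eq_wsum, mul_comm, ← wsum_mul_left]
  simp only [mul_comm]

lemma sum_pr (μ : Ω → ℝ) (X : Ω → A) : ∑ a, pr μ X a = ∑ ω, μ ω := by
  simpa [wsum] using wsum_pr μ X fun _ => 1

lemma Hent_mul_log_two (μ : Ω → ℝ) (X : Ω → A) :
    Hent μ X * Real.log 2 = - wsum μ fun ω => Real.log (pr μ X (X ω)) := by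
  have h2 : Real.log 2 ≠ 0 := (Real.log_pos one_lt_two).ne'
  rw [← wsum_pr μ X fun a => Real.log (pr μ X a), Hent, neg_mul, Finset.sum_mul, wsum]
  congr 1
  refine Finset.sum_congr rfl fun a _ => ?_
  rw [Real.logb, mul_assoc, div_mul_cancel₀ _ h2]

lemma sum_condPr_le_one {B : Type*} (μ : Ω → ℝ) (X : Ω → A) (Y : Ω → B) (y : B) :
    ∑ x, condPr μ X Y x y ≤ 1 := by
  simp only [condPr]
  rw [← Finset.sum_div, sum_pr_pair_left]
  exact div_self_le_one _

lemma wsum_log_condPr {μ : Ω → ℝ} (hμ : ∀ ω, 0 ≤ μ ω) (X : Ω → A) (Y : Ω → B) :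
    (wsum μ fun ω => Real.log (condPr μ X Y (X ω) (Y ω))) = -(condEnt μ X Y * Real.log 2) := by
  rw [condEnt, sub_mul, Hent_mul_log_two, Hent_mul_log_two, sub_neg_eq_add, neg_add_eq_sub, neg_sub,
    ← wsum_sub]
  refine Finset.sum_congr rfl fun ω _ => ?_
  rcases (hμ ω).eq_or_lt with h | h
  · simp [← h]
  · simp only [condPr]
    rw [Real.log_div (pr_self_pos hμ (fun ω => (X ω, Y ω)) h).ne'
      (pr_self_pos hμ Y h).ne']

lemma wsum_log_infoRatio {μ : Ω → ℝ} (hμ : ∀ ω, 0 ≤ μ ω) (X : Ω → A) (Y : Ω → B) (Z : Ω → C) :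
    (wsum μ fun ω => Real.log (infoRatio μ X Y Z (X ω) (Y ω) (Z ω)))
      = condMutInfo μ X Y Z * Real.log 2 := by
  rw [condMutInfo, condEnt, condEnt, sub_mul, sub_mul, sub_mul, Hent_mul_log_two, Hent_mul_log_two,
    Hent_mul_log_two, Hent_mul_log_two]
  have h : ∀ ω, μ ω * Real.log (infoRatio μ X Y Z (X ω) (Y ω) (Z ω))
      = μ ω * ((Real.log (pr μ (fun ω => (X ω, Y ω, Z ω)) (X ω, Y ω, Z ω))
          + Real.log (pr μ Z (Z ω)))
        - (Real.log (pr μ (fun ω => (X ω, Z ω)) (X ω, Z ω))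
          + Real.log (pr μ (fun ω => (Y ω, Z ω)) (Y ω, Z ω)))) := by
    intro ω
    rcases (hμ ω).eq_or_lt with h | h
    · simp [← h]
    · have h1 := (pr_self_pos hμ (fun ω => (X ω, Y ω, Z ω)) h).ne'
      have h2 := (pr_self_pos hμ Z h).ne'
      have h3 := (pr_self_pos hμ (fun ω => (X ω, Z ω)) h).ne'
      have h4 := (pr_self_pos hμ (fun ω => (Y ω, Z ω)) h).ne'
      rw [infoRatio, Real.log_div (mul_ne_zero h1 h2) (mul_ne_zero h3 h4), Real.log_mul h1 h2,
        Real.log_mul h3 h4]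
  have h' := Finset.sum_congr (rfl : (Finset.univ : Finset Ω) = Finset.univ) fun ω _ => h ω
  have h'' := wsum_sub μ (fun ω => Real.log (pr μ (fun ω => (X ω, Y ω, Z ω)) (X ω, Y ω, Z ω))
          + Real.log (pr μ Z (Z ω))) (fun ω => Real.log (pr μ (fun ω => (X ω, Z ω)) (X ω, Z ω))
          + Real.log (pr μ (fun ω => (Y ω, Z ω)) (Y ω, Z ω)))
  rw [wsum_add, wsum_add] at h''
  rw [wsum, h']
  rw [wsum] at h''
  rw [h'']
  ring

/-- If `X` has conditional law `k` given `Z`, then the likelihood ratio evaluated at an independent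
copy of `X` given `Z` has mean at most one. -/
lemma wsum_infoRatio_le_one {μ : Ω → ℝ} (hμ : IsPmf μ) (X : Ω → A) (Y : Ω → B) (Z : Ω → C)
    (k : C → A → ℝ)
    (hk : ∀ F : A → C → ℝ, (wsum μ fun ω => F (X ω) (Z ω))
      = wsum μ fun ω => wsum (k (Z ω)) fun x => F x (Z ω)) :
    (wsum μ fun ω => wsum (k (Z ω)) fun x => infoRatio μ X Y Z x (Y ω) (Z ω)) ≤ 1 := by
  have hk' : ∀ x z, pr μ (fun ω => (X ω, Z ω)) (x, z) = pr μ Z z * k z x := by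
    intro x z
    rw [pr_eq_wsum, pr_eq_wsum]
    have h1 := hk fun x' z' => ind ((x', z') = (x, z))
    rw [h1, mul_comm, ← wsum_mul_left]
    refine congrArg _ (funext fun ω => ?_)
    by_cases h : Z ω = z <;> simp [wsum, ind, h]
  have h1 := wsum_pr μ (fun ω => (Y ω, Z ω))
    fun yz => wsum (k yz.2) fun x => infoRatio μ X Y Z x yz.1 yz.2
  rw [← h1, ← hμ.sum_one, ← sum_pr μ fun ω => (Y ω, Z ω)]
  refine Finset.sum_le_sum fun yz _ => ?_
  rw [← sum_pr_pair_left μ X (fun ω => (Y ω, Z ω))]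
  simp only [wsum]
  rw [Finset.mul_sum]
  refine Finset.sum_le_sum fun x _ => ?_
  obtain ⟨y, z⟩ := yz
  have e : pr μ (fun ω => (Y ω, Z ω)) (y, z) * (k z x * infoRatio μ X Y Z x y z)
      = pr μ (fun ω => (X ω, Y ω, Z ω)) (x, y, z)
        * ((pr μ (fun ω => (X ω, Z ω)) (x, z) * pr μ (fun ω => (Y ω, Z ω)) (y, z))
          / (pr μ (fun ω => (X ω, Z ω)) (x, z) * pr μ (fun ω => (Y ω, Z ω)) (y, z))) := by
    rw [infoRatio, hk']
    ring
  simp only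
  rw [sum_pr_pair_left, e]
  exact mul_le_of_le_one_right (pr_nonneg hμ.nonneg _ _) (div_self_le_one _)

lemma Hent_fst (q : Ω → ℝ) {ν : Ω' → ℝ} (hν : IsPmf ν) (X : Ω → A) :
    Hent (fun z : Ω × Ω' => q z.1 * ν z.2) (fun z => X z.1) = Hent q X := by
  have h : ∀ a, pr (fun z : Ω × Ω' => q z.1 * ν z.2) (fun z => X z.1) a = pr q X a := by
    intro a
    rw [pr_eq_wsum, pr_eq_wsum, wsum_prod_weights q (fun _ => ν) (fun z => ind (X z.1 = a))]
    simp only [wsum_const hν]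
  simp only [Hent, h]

lemma Hent_snd {q : Ω → ℝ} (hq : IsPmf q) (ν : Ω' → ℝ) (X : Ω' → A) :
    Hent (fun z : Ω × Ω' => q z.1 * ν z.2) (fun z => X z.2) = Hent ν X := by
  have h : ∀ a, pr (fun z : Ω × Ω' => q z.1 * ν z.2) (fun z => X z.2) a = pr ν X a := by
    intro a
    rw [pr_eq_wsum, pr_eq_wsum, wsum_prod_weights q (fun _ => ν) (fun z => ind (X z.2 = a))]
    exact wsum_const hq (wsum ν fun b => ind (X b = a))
  simp only [Hent, h]

lemma Hent_equiv_comp (μ : Ω → ℝ) (X : Ω → A) (e : A ≃ B) :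
    Hent μ (fun ω => e (X ω)) = Hent μ X := by
  have h : ∀ a, pr μ (fun ω => e (X ω)) (e a) = pr μ X a := by
    intro a
    simp only [pr_eq_wsum, e.apply_eq_iff_eq]
  simp only [Hent]
  rw [← e.sum_comp]
  simp only [h]

lemma mutInfo_eq_condMutInfo {μ : Ω → ℝ} (hμ : IsPmf μ) (X : Ω → A) (Y : Ω → B) :
    mutInfo μ X Y = condMutInfo μ X Y fun _ => () := by
  have h0 : Hent μ (fun _ => ()) = 0 := by
    simp [Hent, pr, hμ.sum_one]
  have h1 := Hent_equiv_comp μ X (Equiv.prodPUnit A).symm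
  have h2 := Hent_equiv_comp μ Y (Equiv.prodPUnit B).symm
  have h3 := Hent_equiv_comp μ (fun ω => (X ω, Y ω))
    ((Equiv.refl A).prodCongr (Equiv.prodPUnit B).symm)
  simp only [Equiv.prodPUnit_symm_apply, Equiv.prodCongr_apply, Prod.map, Equiv.refl_apply]
    at h1 h2 h3
  rw [mutInfo, condMutInfo, condEnt, condEnt, h0, ← h1, ← h2, ← h3]
  ring

end Entropies

/-! ### Exponential moments and their asymptotics -/

section Asymptotics

open Filter Topology

lemma wsum_rpow_neg_le {Ω : Type*} [Fintype Ω] {p : Ω → ℝ} (hp : IsPmf p) {g : Ω → ℝ}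
    (hg : ∀ ω, 0 < p ω → 0 < g ω) {ε : ℝ} (hε : 0 < ε) :
    ∀ᶠ t in 𝓝[>] (0 : ℝ), (wsum p fun ω => (g ω) ^ (-t))
      ≤ Real.exp (-t * ((wsum p fun ω => Real.log (g ω)) - ε)) := by
  have hd : HasDerivAt (fun t : ℝ => wsum p fun ω => Real.exp (-t * Real.log (g ω)))
      (-(wsum p fun ω => Real.log (g ω))) 0 := by
    have : HasDerivAt (fun t : ℝ => ∑ ω, p ω * Real.exp (-t * Real.log (g ω)))
        (∑ ω, p ω * (Real.exp (-(0 : ℝ) * Real.log (g ω)) * (-1 * Real.log (g ω)))) 0 :=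
      HasDerivAt.fun_sum fun ω _ =>
        (((hasDerivAt_id (0 : ℝ)).neg.mul_const (Real.log (g ω))).exp).const_mul (p ω)
    convert this using 1 <;> simp [wsum]
  have hlim := hd.tendsto_slope_zero_right
  have hlt : -(wsum p fun ω => Real.log (g ω)) <
      -(wsum p fun ω => Real.log (g ω)) + ε := by linarith
  filter_upwards [hlim.eventually (gt_mem_nhds hlt), self_mem_nhdsWithin] with t ht ht0
  have ht0 : 0 < t := ht0
  have h1 : (wsum p fun ω => (g ω) ^ (-t)) = wsum p fun ω => Real.exp (-t * Real.log (g ω)) := by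
    refine Finset.sum_congr rfl fun ω _ => ?_
    rcases (hp.nonneg ω).eq_or_lt with h | h
    · simp [← h]
    · simp only
      rw [Real.rpow_def_of_pos (hg ω h), mul_comm (-t)]
  have h0 : (wsum p fun ω => Real.exp (-0 * Real.log (g ω))) = 1 := by
    simpa using wsum_const hp 1
  simp only [zero_add, smul_eq_mul, h0] at ht
  rw [inv_mul_lt_iff₀ ht0] at ht
  rw [h1]
  refine le_trans ?_ (Real.add_one_le_exp _)
  nlinarith

/-- The first-order comparison `H u < I v` forces the exponential decay of the bound on the
probability that the correct message fails the threshold test. -/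
lemma exists_rpow_mul_pow_mul_pow_small {α β : ℝ → ℝ} (hα0 : ∀ t, 0 ≤ α t) (hβ0 : ∀ t, 0 ≤ β t)
    {H I u v : ℝ} (hu : 0 < u) (hv : 0 < v) (hlt : H * u < I * v)
    (hα : ∀ ε > 0, ∀ᶠ t in 𝓝[>] (0 : ℝ), α t ≤ Real.exp (t * (H + ε)))
    (hβ : ∀ ε > 0, ∀ᶠ t in 𝓝[>] (0 : ℝ), β t ≤ Real.exp (-t * (I - ε))) :
    ∃ t > 0, ∀ δ > 0, ∃ m0 : ℕ, ∀ m > m0, ∀ k n : ℕ, |(k : ℝ) - u * m| ≤ 1 →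
      |(n : ℝ) - v * m| ≤ 1 → (m : ℝ) ^ t * α t ^ k * β t ^ n ≤ δ := by
  set ε : ℝ := (I * v - H * u) / (2 * (u + v)) with hεdef
  have hε : 0 < ε := div_pos (by linarith) (by linarith)
  have hεeq : ε * (2 * (u + v)) = I * v - H * u := by
    rw [hεdef, div_mul_cancel₀ _ (by positivity)]
  set gap : ℝ := ε * (u + v) with hgap
  have hgap0 : 0 < gap := by positivity
  have hgapeq : (H + ε) * u - (I - ε) * v = -gap := by rw [hgap]; linarith
  obtain ⟨t, ⟨htα, htβ⟩, ht⟩ := (((hα ε hε).and (hβ ε hε)).and self_mem_nhdsWithin).exists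
  have ht : 0 < t := ht
  refine ⟨t, ht, fun δ hδ => ?_⟩
  set Cst : ℝ := |H + ε| + |I - ε| with hC
  have hlim := (tendsto_rpow_mul_exp_neg_mul_atTop_nhds_zero t (t * gap) (by positivity)).comp
    tendsto_natCast_atTop_atTop
  have hev := hlim.eventually (gt_mem_nhds (mul_pos hδ (Real.exp_pos (-(t * Cst)))))
  obtain ⟨m0, hm0⟩ := eventually_atTop.1 hev
  refine ⟨m0, fun m hm k n hk hn => ?_⟩
  have hmm := hm0 m hm.le
  simp only [Function.comp] at hmm
  have h1 : α t ^ k * β t ^ n ≤ Real.exp (-(t * gap) * m) * Real.exp (t * Cst) := by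
    calc α t ^ k * β t ^ n ≤ Real.exp (t * (H + ε)) ^ k * Real.exp (-t * (I - ε)) ^ n :=
          mul_le_mul (pow_le_pow_left₀ (hα0 t) htα k) (pow_le_pow_left₀ (hβ0 t) htβ n)
            (pow_nonneg (hβ0 t) n) (by positivity)
      _ = Real.exp (k * (t * (H + ε)) + n * (-t * (I - ε))) := by
          rw [Real.exp_add, Real.exp_nat_mul, Real.exp_nat_mul]
      _ ≤ Real.exp (-(t * gap) * m + t * Cst) := by
          refine Real.exp_le_exp.2 ?_
          have e1 : ((k : ℝ) - u * m) * (H + ε) ≤ |H + ε| := by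
            refine (le_abs_self _).trans ?_
            rw [abs_mul]
            exact mul_le_of_le_one_left (abs_nonneg _) hk
          have e2 : -(((n : ℝ) - v * m) * (I - ε)) ≤ |I - ε| := by
            refine (neg_le_abs _).trans ?_
            rw [abs_mul]
            exact mul_le_of_le_one_left (abs_nonneg _) hn
          have e3 : (k : ℝ) * (H + ε) - n * (I - ε) ≤ -gap * m + Cst := by
            rw [← hgapeq, hC]
            linarith
          have := mul_le_mul_of_nonneg_left e3 ht.le
          linarith
      _ = _ := Real.exp_add _ _
  calc (m : ℝ) ^ t * α t ^ k * β t ^ n = (m : ℝ) ^ t * (α t ^ k * β t ^ n) := by ring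
    _ ≤ (m : ℝ) ^ t * (Real.exp (-(t * gap) * m) * Real.exp (t * Cst)) :=
        mul_le_mul_of_nonneg_left h1 (by positivity)
    _ = ((m : ℝ) ^ t * Real.exp (-(t * gap) * m)) * Real.exp (t * Cst) := by ring
    _ ≤ (δ * Real.exp (-(t * Cst))) * Real.exp (t * Cst) :=
        mul_le_mul_of_nonneg_right hmm.le (by positivity)
    _ = δ := by rw [mul_assoc, ← Real.exp_add]; simp

end Asymptotics

/-! ### Block-Markov assembly of a code -/

section BlockMarkov

lemma wsum_piPmf_map {I A B : Type*} [Fintype I] [DecidableEq I] [Fintype A] [Fintype B]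
    (p : I → A → ℝ) (φ : A → B) (F : (I → B) → ℝ) :
    wsum (piPmf p) (fun z => F fun i => φ (z i)) = wsum (piPmf fun i => pr (p i) φ) F := by
  have h : ∀ z : I → A, F (fun i => φ (z i)) = ∑ g, F g * ∏ i, ind (φ (z i) = g i) := by
    intro z
    have : ∀ g : I → B, ∏ i, ind (φ (z i) = g i) = ind ((fun i => φ (z i)) = g) := by
      intro g
      by_cases hg : (fun i => φ (z i)) = g
      · rw [ind_of_true hg]
        exact Finset.prod_eq_one fun i _ => ind_of_true (congrFun hg i)
      · rw [ind_of_false hg]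
        obtain ⟨i, hi⟩ := Function.ne_iff.1 hg
        exact Finset.prod_eq_zero (Finset.mem_univ i) (ind_of_false hi)
    simp only [this]
    simp [ind]
  simp only [h]
  rw [wsum_sum]
  refine Finset.sum_congr rfl fun g _ => ?_
  rw [wsum_mul_left, wsum_piPmf_prod p fun i a => ind (φ a = g i), mul_comm]
  simp only [piPmf, pr_eq_wsum]

/-- A process generated by causal stochastic kernels has total mass one. -/
lemma sum_causal_prod {Z : Type*} [Fintype Z] : ∀ {n : ℕ} (κ : (k : Fin n) → (Fin k → Z) → Z → ℝ),
    (∀ k z, ∑ a, κ k z a = 1) →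
    ∑ z : Fin n → Z, ∏ k, κ k (fun j => z ⟨j, j.isLt.trans k.isLt⟩) (z k) = 1 := by
  intro n
  induction n with
  | zero => intro κ _; simp
  | succ n ih =>
    intro κ hκ
    rw [← (Fin.snocEquiv fun _ : Fin (n + 1) => Z).sum_comp, Fintype.sum_prod_type_right]
    rw [← ih (fun k z => κ k.castSucc z) fun k z => hκ k.castSucc z]
    refine Finset.sum_congr rfl fun z _ => ?_
    have h : ∀ a : Z, (Fin.snocEquiv fun _ : Fin (n + 1) => Z) (a, z) = Fin.snoc z a := fun a => rfl
    have h1 : ∀ (a : Z) (i : Fin n),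
        (fun j : Fin i.castSucc => (Fin.snoc z a : Fin (n + 1) → Z)
          ⟨j, j.isLt.trans i.castSucc.isLt⟩) = fun j : Fin i => z ⟨j, j.isLt.trans i.isLt⟩ := by
      intro a i
      funext j
      exact Fin.snoc_castSucc (α := fun _ => Z) a z ⟨j, j.isLt.trans i.isLt⟩
    have h2 : ∀ a : Z, (fun j : Fin (Fin.last n) => (Fin.snoc z a : Fin (n + 1) → Z)
          ⟨j, j.isLt.trans (Fin.last n).isLt⟩) = z := by
      intro a
      funext j
      exact Fin.snoc_castSucc (α := fun _ => Z) a z j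
    simp only [h, Fin.prod_univ_castSucc, Fin.snoc_castSucc, Fin.snoc_last, h1, h2]
    rw [← Finset.mul_sum, hκ, mul_one]

/-- The channel as a law on pairs of outputs. -/
def chan (ch : DMMARC X1 X2 X3 Y Y3) (x1 : X1) (x2 : X2) (x3 : X3) (o : Y × Y3) : ℝ :=
  ch.P x1 x2 x3 o.1 o.2

lemma isPmf_chan (ch : DMMARC X1 X2 X3 Y Y3) (x1 : X1) (x2 : X2) (x3 : X3) :
    IsPmf (chan ch x1 x2 x3) where
  nonneg o := ch.nonneg _ _ _ _ _
  sum_one := by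
    rw [Fintype.sum_prod_type]
    exact ch.sum_one _ _ _

/-- The sequence on `ℕ` that continues a finite sequence by a constant. -/
def extendSeq {A : Type*} {k : ℕ} (a : A) (y : Fin k → A) (i : ℕ) : A :=
  if h : i < k then y ⟨i, h⟩ else a

/-- The source block that is encoded freshly in channel block `b - 1`; padded by the letter `d`. -/
def srcBlock {S : Type*} {m k : ℕ} (B : ℕ) (σ : ℕ → Fin k → Fin m) (d : S) (s : Fin m → S) :
    ℕ → Fin k → S
  | 0 => fun _ => d
  | b + 1 => if b < B then fun i => s (σ b i) else fun _ => d

/-- Forward block-by-block decoding at the relay. -/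
def relayEst {M O D : Type*} {m k : ℕ} (B l : ℕ) (σ : ℕ → Fin k → Fin m) (x0 : M)
    (dec : M → (Fin l → O) → (Fin k → D) → M) (y : ℕ → O) (w : Fin m → D) : ℕ → M
  | 0 => x0
  | b + 1 => if b < B then
      dec (relayEst B l σ x0 dec y w b) (fun j => y (b * l + j)) (fun i => w (σ b i)) else x0

/-- Backward block-by-block decoding at the destination. -/
def destEst {M O D : Type*} {m k : ℕ} (B l : ℕ) (σ : ℕ → Fin k → Fin m) (x0 : M)
    (dec : M → (Fin l → O) → (Fin k → D) → M) (y : ℕ → O) (w : Fin m → D) : ℕ → M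
  | 0 => x0
  | j + 1 => dec (destEst B l σ x0 dec y w j) (fun i => y ((B - j) * l + i))
      (fun i => w (σ (B - j - 1) i))

lemma relayEst_congr {M O D : Type*} {m k : ℕ} (B l : ℕ) (σ : ℕ → Fin k → Fin m) (x0 : M)
    (dec : M → (Fin l → O) → (Fin k → D) → M) {y y' : ℕ → O} (w : Fin m → D) :
    ∀ b : ℕ, (∀ i < b * l, y i = y' i) →
      relayEst B l σ x0 dec y w b = relayEst B l σ x0 dec y' w b := by
  intro b
  induction b with
  | zero => intro _; rfl
  | succ b ih =>
    intro h
    have h1 : ∀ i < b * l, y i = y' i := fun i hi =>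
      h i (hi.trans_le (Nat.mul_le_mul_right l (Nat.le_succ b)))
    have h2 : (fun j : Fin l => y (b * l + j)) = fun j : Fin l => y' (b * l + j) := by
      funext j
      refine h _ ?_
      rw [Nat.succ_mul]
      exact Nat.add_lt_add_left j.isLt _
    simp only [relayEst, ih h1, h2]

lemma relayEst_eq {M O D : Type*} {m k : ℕ} {B l : ℕ} {σ : ℕ → Fin k → Fin m} {x0 : M}
    {dec : M → (Fin l → O) → (Fin k → D) → M} {y : ℕ → O} {w : Fin m → D} {x : ℕ → M}
    (hx0 : x 0 = x0) (hxB : ∀ b, B ≤ b → x (b + 1) = x0)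
    (h : ∀ b < B, dec (x b) (fun j => y (b * l + j)) (fun i => w (σ b i)) = x (b + 1)) (b : ℕ) :
    relayEst B l σ x0 dec y w b = x b := by
  induction b with
  | zero => exact hx0.symm
  | succ b ih =>
    rw [relayEst, ih]
    split_ifs with hb
    · exact h b hb
    · exact (hxB b (not_lt.1 hb)).symm

lemma destEst_eq {M O D : Type*} {m k : ℕ} {B l : ℕ} {σ : ℕ → Fin k → Fin m} {x0 : M}
    {dec : M → (Fin l → O) → (Fin k → D) → M} {y : ℕ → O} {w : Fin m → D} {x : ℕ → M}
    (hxB : x (B + 1) = x0)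
    (h : ∀ b < B, dec (x (b + 2)) (fun j => y ((b + 1) * l + j)) (fun i => w (σ b i)) = x (b + 1)) :
    ∀ j ≤ B, destEst B l σ x0 dec y w j = x (B + 1 - j) := by
  intro j
  induction j with
  | zero => intro _; exact hxB.symm
  | succ j ih =>
    intro hj
    obtain ⟨b, rfl⟩ := Nat.exists_eq_add_of_le hj
    have e1 : j + 1 + b + 1 - j = b + 2 := by omega
    have e2 : j + 1 + b - j = b + 1 := by omega
    have e3 : j + 1 + b - j - 1 = b := by omega
    have e4 : j + 1 + b + 1 - (j + 1) = b + 1 := by omega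
    rw [destEst, ih (by omega), e1, e2, e4, Nat.add_sub_cancel]
    exact h b (by omega)

end BlockMarkov

section BlockMarkovCode

/-- Two laws that agree on an event give its complement the same probability. -/
lemma wsum_ind_le_of_agree {Z : Type*} [Fintype Z] {P Q : Z → ℝ} (hP : IsPmf P) (hQ : IsPmf Q)
    {E G : Z → Prop} (hE : ∀ z, G z → ¬ E z) (hPQ : ∀ z, G z → P z = Q z) :
    wsum P (fun z => ind (E z)) ≤ wsum Q fun z => ind (¬ G z) := by
  have hcompl : ∀ {R : Z → ℝ}, IsPmf R →
      wsum R (fun z => ind (¬ G z)) = 1 - wsum R fun z => ind (G z) := by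
    intro R hR
    rw [← wsum_const hR 1, ← wsum_sub]
    congr 1
    funext z
    by_cases h : G z <;> simp [ind, h]
  have hGG : wsum P (fun z => ind (G z)) = wsum Q fun z => ind (G z) := by
    refine Finset.sum_congr rfl fun z _ => ?_
    by_cases h : G z
    · rw [hPQ z h]
    · simp [ind, h]
  calc wsum P (fun z => ind (E z)) ≤ wsum P fun z => ind (¬ G z) :=
        wsum_mono hP.nonneg fun z _ => ind_mono fun h1 h2 => hE z h2 h1
    _ = wsum Q fun z => ind (¬ G z) := by rw [hcompl hP, hcompl hQ, hGG]

/-- The pair of source blocks at position `b`. -/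
def srcPair {m k : ℕ} (B : ℕ) (σ : ℕ → Fin k → Fin m) (d : S1 × S2)
    (s : Fin m → S1 × S2 × W × W3) (b : ℕ) : (Fin k → S1) × (Fin k → S2) :=
  (srcBlock B σ d.1 (fun i => (s i).1) b, srcBlock B σ d.2 (fun i => (s i).2.1) b)

lemma srcPair_succ {A1 A2 D D3 : Type} {m k B : ℕ} (σ : ℕ → Fin k → Fin m) (d : A1 × A2)
    (s : Fin m → A1 × A2 × D × D3) {b : ℕ} (hb : b < B) :
    srcPair B σ d s (b + 1) = (fun i => (s (σ b i)).1, fun i => (s (σ b i)).2.1) := by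
  simp [srcPair, srcBlock, hb]

/-- Joint output law of the letters of a channel block in which the fresh message is `b` and the
message of the preceding block is `a`. -/
def blockLaw {M1 M2 : Type*} {l : ℕ} (ch : DMMARC X1 X2 X3 Y Y3) (x1c : M1 → M1 → Fin l → X1)
    (x2c : M2 → M2 → Fin l → X2) (x3c : M1 → M2 → Fin l → X3) (a b : M1 × M2) (j : Fin l) :
    Y × Y3 → ℝ :=
  chan ch (x1c a.1 b.1 j) (x2c a.2 b.2 j) (x3c a.1 a.2 j)

/-- A block-Markov code; its error probability is bounded by the sum of the error probabilities of
the block decoders when these are given the correct neighbouring block. -/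
theorem exists_blockMarkov_code (src : SourcePMF (S1 × S2 × W × W3)) (ch : DMMARC X1 X2 X3 Y Y3)
    {m n k l B : ℕ} (hl : 0 < l) (hn : (B + 1) * l ≤ n) (σ : ℕ → Fin k → Fin m)
    (hσ : ∀ i, ∃ b < B, ∃ j, σ b j = i) (d : S1 × S2) (y0 : Y) (y30 : Y3)
    (x1c : (Fin k → S1) → (Fin k → S1) → Fin l → X1)
    (x2c : (Fin k → S2) → (Fin k → S2) → Fin l → X2)
    (x3c : (Fin k → S1) → (Fin k → S2) → Fin l → X3)
    (dec3 : (Fin k → S1) × (Fin k → S2) → (Fin l → Y3) → (Fin k → W3) →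
      (Fin k → S1) × (Fin k → S2))
    (dec : (Fin k → S1) × (Fin k → S2) → (Fin l → Y) → (Fin k → W) →
      (Fin k → S1) × (Fin k → S2)) :
    ∃ c : MABRCCode S1 S2 W W3 X1 X2 X3 Y Y3 m n, mabrcErr src ch c ≤
      wsum (piPmf fun _ : Fin m => src.q) fun s =>
        (∑ b : Fin B, wsum (piPmf fun j => pr (blockLaw ch x1c x2c x3c
            (srcPair B σ d s b) (srcPair B σ d s (b + 1)) j) Prod.snd) fun o =>
          ind (dec3 (srcPair B σ d s b) o (fun i => (s (σ b i)).2.2.2) ≠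
            srcPair B σ d s (b + 1))) +
        ∑ b : Fin B, wsum (piPmf fun j => pr (blockLaw ch x1c x2c x3c
            (srcPair B σ d s (b + 1)) (srcPair B σ d s (b + 2)) j) Prod.fst) fun o =>
          ind (dec (srcPair B σ d s (b + 2)) o (fun i => (s (σ b i)).2.2.1) ≠
            srcPair B σ d s (b + 1)) := by
  choose β hβ ι hι using hσ
  let x0 : (Fin k → S1) × (Fin k → S2) := (fun _ => d.1, fun _ => d.2)
  let md : ℕ → Fin l := fun i => ⟨i % l, Nat.mod_lt _ hl⟩
  let est : (ℕ → Y3) → (Fin m → W3) → ℕ → (Fin k → S1) × (Fin k → S2) := relayEst B l σ x0 dec3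
  let dst : (ℕ → Y) → (Fin m → W) → ℕ → (Fin k → S1) × (Fin k → S2) := destEst B l σ x0 dec
  let c : MABRCCode S1 S2 W W3 X1 X2 X3 Y Y3 m n :=
    { f1 := fun s i => x1c (srcBlock B σ d.1 s (i / l)) (srcBlock B σ d.1 s (i / l + 1)) (md i)
      f2 := fun s i => x2c (srcBlock B σ d.2 s (i / l)) (srcBlock B σ d.2 s (i / l + 1)) (md i)
      f3 := fun i past w => x3c (est (extendSeq y30 past) w (i / l)).1
        (est (extendSeq y30 past) w (i / l)).2 (md i)
      g := fun y w => (fun i => (dst (extendSeq y0 y) w (B - β i)).1 (ι i),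
        fun i => (dst (extendSeq y0 y) w (B - β i)).2 (ι i))
      g3 := fun y w => (fun i => (est (extendSeq y30 y) w (β i + 1)).1 (ι i),
        fun i => (est (extendSeq y30 y) w (β i + 1)).2 (ι i)) }
  refine ⟨c, ?_⟩
  have herr : mabrcErr src ch c = wsum (piPmf fun _ : Fin m => src.q) fun s =>
      wsum (fun z : Fin n → Y × Y3 => ∏ i, chan ch (c.f1 (fun i => (s i).1) i)
        (c.f2 (fun i => (s i).2.1) i)
        (relayIn c (fun i => (z i).2) (fun i => (s i).2.2.2) i) (z i)) fun z =>
      ind (c.g (fun i => (z i).1) (fun i => (s i).2.2.1) ≠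
          (fun i => (s i).1, fun i => (s i).2.1) ∨
        c.g3 (fun i => (z i).2) (fun i => (s i).2.2.2) ≠
          (fun i => (s i).1, fun i => (s i).2.1)) := by
    unfold mabrcErr
    rw [Fintype.sum_prod_type]
    refine Finset.sum_congr rfl fun s _ => ?_
    simp only [wsum, Finset.mul_sum]
    rw [← (Equiv.arrowProdEquivProdArrow (Fin n) (fun _ => Y)
      (fun _ => Y3)).sum_comp]
    refine Finset.sum_congr rfl fun z _ => ?_
    simp only [Equiv.arrowProdEquivProdArrow, Equiv.coe_fn_mk, mabrcLaw, ind, piPmf, chan]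
    split_ifs <;> ring
  rw [herr]
  refine wsum_mono (isPmf_piPmf fun _ => ⟨src.nonneg, src.sum_one⟩).nonneg fun s _ => ?_
  let x : ℕ → (Fin k → S1) × (Fin k → S2) := srcPair B σ d s
  let gin : Fin n → Y × Y3 → ℝ := fun i =>
    blockLaw ch x1c x2c x3c (x (i / l)) (x (i / l + 1)) (md i)
  have hx0 : x 0 = x0 := rfl
  have hxB : ∀ b, B ≤ b → x (b + 1) = x0 := fun b hb => by
    simp [x, srcPair, srcBlock, x0, not_lt.2 hb]
  have hτ : ∀ b ≤ B, ∀ j : Fin l, b * l + j < n := fun b hb j => by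
    have h1 : (b + 1) * l ≤ (B + 1) * l := Nat.mul_le_mul_right l (by omega)
    have h2 : (b + 1) * l = b * l + l := by ring
    have := j.isLt
    omega
  let τ : (b : ℕ) → b ≤ B → Fin l → Fin n := fun b hb j => ⟨b * l + j, hτ b hb j⟩
  have hτinj : ∀ b hb, Function.Injective (τ b hb) := fun b hb j j' h => by
    have := Fin.mk.inj_iff.1 h
    exact Fin.ext (by omega)
  have hgin : ∀ b hb, (fun j => gin (τ b hb j)) = blockLaw ch x1c x2c x3c (x b) (x (b + 1)) := by
    intro b hb
    funext j
    have h1 : (b * l + (j : ℕ)) / l = b := by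
      rw [mul_comm, Nat.mul_add_div hl, Nat.div_eq_of_lt j.isLt, add_zero]
    have h2 : md (b * l + j) = j := Fin.ext (by
      simp only [md]
      rw [mul_comm, Nat.mul_add_mod, Nat.mod_eq_of_lt j.isLt])
    simp only [gin, τ, h1, h2]
  let G3 : (Fin n → Y × Y3) → Fin B → Prop := fun z b =>
    dec3 (x b) (fun j => (z (τ b b.isLt.le j)).2) (fun i => (s (σ b i)).2.2.2) = x (b + 1)
  let GD : (Fin n → Y × Y3) → Fin B → Prop := fun z b =>
    dec (x (b + 2)) (fun j => (z (τ (b + 1) b.isLt j)).1) (fun i => (s (σ b i)).2.2.1) = x (b + 1)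
  have hest : ∀ z, (∀ b, G3 z b) → ∀ b,
      est (extendSeq y30 fun i => (z i).2) (fun i => (s i).2.2.2) b = x b := by
    intro z hz b
    refine relayEst_eq hx0 hxB (fun b hb => ?_) b
    have := hz ⟨b, hb⟩
    simp only [G3, τ] at this
    rw [← this]
    congr 1
    funext j
    simp [extendSeq, hτ b hb.le j]
  have hdst : ∀ z, (∀ b, GD z b) → ∀ j ≤ B,
      dst (extendSeq y0 fun i => (z i).1) (fun i => (s i).2.2.1) j = x (B + 1 - j) := by
    intro z hz
    refine destEst_eq (hxB B le_rfl) fun b hb => ?_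
    have := hz ⟨b, hb⟩
    simp only [GD, τ] at this
    rw [← this]
    congr 1
    funext j
    simp [extendSeq, hτ (b + 1) hb j]
  have hxs : ∀ i, (x (β i + 1)).1 (ι i) = (s i).1 ∧ (x (β i + 1)).2 (ι i) = (s i).2.1 := by
    intro i
    simp only [x, srcPair_succ σ d s (hβ i), hι, and_self]
  have hagree := wsum_ind_le_of_agree
    (P := fun z : Fin n → Y × Y3 => ∏ i, chan ch (c.f1 (fun i => (s i).1) i)
        (c.f2 (fun i => (s i).2.1) i)
        (relayIn c (fun i => (z i).2) (fun i => (s i).2.2.2) i) (z i))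
    (Q := piPmf gin) (G := fun z => (∀ b, G3 z b) ∧ ∀ b, GD z b)
    (E := fun z => c.g (fun i => (z i).1) (fun i => (s i).2.2.1) ≠
          (fun i => (s i).1, fun i => (s i).2.1) ∨
        c.g3 (fun i => (z i).2) (fun i => (s i).2.2.2) ≠
          (fun i => (s i).1, fun i => (s i).2.1))
    ⟨fun z => Finset.prod_nonneg fun i _ => (isPmf_chan ch _ _ _).nonneg _,
      sum_causal_prod (fun i past => chan ch (c.f1 (fun i => (s i).1) i)
        (c.f2 (fun i => (s i).2.1) i) (c.f3 i (fun j => (past j).2) fun i => (s i).2.2.2))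
        fun i past => (isPmf_chan ch _ _ _).sum_one⟩
    (isPmf_piPmf fun i => isPmf_chan ch _ _ _)
    (by
      rintro z ⟨hz3, hzD⟩
      rw [not_or, not_not, not_not]
      constructor
      · refine Prod.ext (funext fun i => ?_) (funext fun i => ?_) <;>
        · simp only [c]
          rw [hdst z hzD _ (Nat.sub_le _ _),
            show B + 1 - (B - β i) = β i + 1 by have := hβ i; omega]
          first | exact (hxs i).1 | exact (hxs i).2
      · refine Prod.ext (funext fun i => ?_) (funext fun i => ?_) <;>
        · simp only [c]
          rw [hest z hz3]
          first | exact (hxs i).1 | exact (hxs i).2)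
    (by
      rintro z ⟨hz3, hzD⟩
      refine Finset.prod_congr rfl fun i _ => ?_
      have h : est (extendSeq y30 fun j : Fin i => (z ⟨j, j.isLt.trans i.isLt⟩).2)
          (fun i => (s i).2.2.2) (i / l) = x (i / l) := by
        rw [← hest z hz3]
        refine relayEst_congr B l σ x0 dec3 _ _ fun i' hi' => ?_
        have h1 : i' < i := hi'.trans_le (Nat.div_mul_le_self _ _)
        simp [extendSeq, h1, h1.trans i.isLt]
      simp only [gin, blockLaw, relayIn, c, h]
      rfl)
  refine hagree.trans ?_
  have hunion : ∀ z, ind (¬ ((∀ b, G3 z b) ∧ ∀ b, GD z b)) ≤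
      (∑ b, ind (¬ G3 z b)) + ∑ b, ind (¬ GD z b) := by
    intro z
    by_cases h : (∀ b, G3 z b) ∧ ∀ b, GD z b
    · rw [ind_of_false (not_not.2 h)]
      exact add_nonneg (Finset.sum_nonneg fun _ _ => ind_nonneg _)
        (Finset.sum_nonneg fun _ _ => ind_nonneg _)
    · rw [ind_of_true h]
      rw [not_and_or, not_forall, not_forall] at h
      rcases h with ⟨b, hb⟩ | ⟨b, hb⟩
      · have := Finset.single_le_sum (f := fun b => ind (¬ G3 z b)) (fun _ _ => ind_nonneg _)
          (Finset.mem_univ b)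
        rw [← ind_of_true hb]
        exact this.trans (le_add_of_nonneg_right (Finset.sum_nonneg fun _ _ => ind_nonneg _))
      · have := Finset.single_le_sum (f := fun b => ind (¬ GD z b)) (fun _ _ => ind_nonneg _)
          (Finset.mem_univ b)
        rw [← ind_of_true hb]
        exact this.trans (le_add_of_nonneg_left (Finset.sum_nonneg fun _ _ => ind_nonneg _))
  have hginp : ∀ i, IsPmf (gin i) := fun i => isPmf_chan ch _ _ _
  refine (wsum_mono (isPmf_piPmf hginp).nonneg fun z _ => hunion z).trans_eq ?_
  rw [wsum_add, wsum_sum, wsum_sum]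
  congr 1
  · refine Finset.sum_congr rfl fun b _ => ?_
    rw [← wsum_piPmf_map, ← hgin b b.isLt.le]
    exact wsum_piPmf_comp hginp (hτinj b b.isLt.le) fun z =>
      ind (¬ dec3 (x b) (fun j => (z j).2) (fun i => (s (σ b i)).2.2.2) = x (b + 1))
  · refine Finset.sum_congr rfl fun b _ => ?_
    rw [← wsum_piPmf_map, ← hgin (b + 1) b.isLt]
    exact wsum_piPmf_comp hginp (hτinj (b + 1) b.isLt) fun z =>
      ind (¬ dec (x (b + 2)) (fun j => (z j).1) (fun i => (s (σ b i)).2.2.1) = x (b + 1))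

end BlockMarkovCode

/-! ### The random codebook of a single channel use -/

section Codebook

lemma wsum_congr {A : Type*} [Fintype A] {p f g : A → ℝ} (h : ∀ a, f a = g a) :
    wsum p f = wsum p g := by
  rw [funext h]

lemma wsum_comm_two {A B C : Type*} [Fintype A] [Fintype B] [Fintype C] (p : A → ℝ)
    (q : A → B → ℝ) (r : C → ℝ) (f : A → B → C → ℝ) :
    (wsum p fun a => wsum (q a) fun b => wsum r fun c => f a b c) =
      wsum r fun c => wsum p fun a => wsum (q a) fun b => f a b c :=
  (wsum_congr fun _ => wsum_comm _ _ _).trans (wsum_comm _ _ _)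

lemma wsum_comm_three {A B C D : Type*} [Fintype A] [Fintype B] [Fintype C] [Fintype D]
    (p : A → ℝ) (q : A → B → ℝ) (r : A → B → C → ℝ) (u : D → ℝ) (f : A → B → C → D → ℝ) :
    (wsum p fun a => wsum (q a) fun b => wsum (r a b) fun c => wsum u fun d => f a b c d) =
      wsum u fun d => wsum p fun a => wsum (q a) fun b => wsum (r a b) fun c => f a b c d :=
  (wsum_congr fun _ => wsum_comm_two _ _ _ _).trans (wsum_comm _ _ _)

lemma wsum_comm_four {A B C D E : Type*} [Fintype A] [Fintype B] [Fintype C] [Fintype D]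
    [Fintype E] (p : A → ℝ) (q : A → B → ℝ) (r : A → B → C → ℝ) (u : A → B → C → D → ℝ)
    (v : E → ℝ) (f : A → B → C → D → E → ℝ) :
    (wsum p fun a => wsum (q a) fun b => wsum (r a b) fun c => wsum (u a b c) fun d =>
        wsum v fun e => f a b c d e) =
      wsum v fun e => wsum p fun a => wsum (q a) fun b => wsum (r a b) fun c =>
        wsum (u a b c) fun d => f a b c d e :=
  (wsum_congr fun _ => wsum_comm_three _ _ _ _ _).trans (wsum_comm _ _ _)

/-- The weights of a pair whose second component is drawn from a kernel. -/
def prodKernel {A B : Type*} (p : A → ℝ) (k : A → B → ℝ) (z : A × B) : ℝ := p z.1 * k z.1 z.2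

lemma wsum_prodKernel {A B : Type*} [Fintype A] [Fintype B] (p : A → ℝ) (k : A → B → ℝ)
    (f : A × B → ℝ) : wsum (prodKernel p k) f = wsum p fun a => wsum (k a) fun b => f (a, b) :=
  wsum_prod_weights p k f

lemma isPmf_prodKernel {A B : Type*} [Fintype A] [Fintype B] {p : A → ℝ} {k : A → B → ℝ}
    (hp : IsPmf p) (hk : ∀ a, IsPmf (k a)) : IsPmf (prodKernel p k) where
  nonneg z := mul_nonneg (hp.nonneg _) ((hk _).nonneg _)
  sum_one := by
    have h := wsum_prodKernel p k fun _ => 1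
    simp only [wsum_const (hk _), wsum_const hp] at h
    simpa [wsum] using h

lemma isPmf_pr {A B : Type*} [Fintype A] [Fintype B] {p : A → ℝ} (hp : IsPmf p) (X : A → B) :
    IsPmf (pr p X) where
  nonneg := pr_nonneg hp.nonneg X
  sum_one := by rw [sum_pr, hp.sum_one]

/-- The input distribution `p(v1) p(x1|v1) p(v2) p(x2|v2) p(x3|v1,v2)`. -/
structure InputDist (V1 V2 X1 X2 X3 : Type) [Fintype V1] [Fintype V2] [Fintype X1] [Fintype X2]
    [Fintype X3] where
  v1 : V1 → ℝ
  v2 : V2 → ℝ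
  x1 : V1 → X1 → ℝ
  x2 : V2 → X2 → ℝ
  x3 : V1 → V2 → X3 → ℝ
  isPmf_v1 : IsPmf v1
  isPmf_v2 : IsPmf v2
  isPmf_x1 : ∀ a, IsPmf (x1 a)
  isPmf_x2 : ∀ a, IsPmf (x2 a)
  isPmf_x3 : ∀ a b, IsPmf (x3 a b)

namespace InputDist

variable (P : InputDist V1 V2 X1 X2 X3)

/-- The law of `(V1, V2, X1, X2, X3)`. -/
def law : V1 × V2 × X1 × X2 × X3 → ℝ :=
  prodKernel P.v1 fun v1 => prodKernel P.v2 fun v2 => prodKernel (P.x1 v1) fun _ =>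
    prodKernel (P.x2 v2) fun _ => P.x3 v1 v2

lemma isPmf_law : IsPmf P.law :=
  isPmf_prodKernel P.isPmf_v1 fun v1 => isPmf_prodKernel P.isPmf_v2 fun v2 =>
    isPmf_prodKernel (P.isPmf_x1 v1) fun _ => isPmf_prodKernel (P.isPmf_x2 v2) fun _ =>
      P.isPmf_x3 v1 v2

lemma wsum_law (F : V1 × V2 × X1 × X2 × X3 → ℝ) :
    wsum P.law F = wsum P.v1 fun v1 => wsum P.v2 fun v2 => wsum (P.x1 v1) fun x1 =>
      wsum (P.x2 v2) fun x2 => wsum (P.x3 v1 v2) fun x3 => F (v1, v2, x1, x2, x3) := by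
  simp only [law, wsum_prodKernel]

end InputDist

/-- Codebooks for one channel use: auxiliary letters are indexed by the message of the preceding
block, source inputs by the preceding and the fresh message. -/
abbrev Codebook (M1 M2 V1 V2 X1 X2 X3 : Type) : Type :=
  (M1 → V1) × (M2 → V2) × (M1 × M1 → X1) × (M2 × M2 → X2) × (M1 × M2 → X3)

/-- The letters used when the preceding message is `a` and the fresh message is `b`. -/
def Codebook.letters {M1 M2 V1 V2 X1 X2 X3 : Type} (c : Codebook M1 M2 V1 V2 X1 X2 X3)
    (a b : M1 × M2) : V1 × V2 × X1 × X2 × X3 :=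
  (c.1 a.1, c.2.1 a.2, c.2.2.1 (a.1, b.1), c.2.2.2.1 (a.2, b.2), c.2.2.2.2 (a.1, a.2))

namespace InputDist

variable {M1 M2 : Type} [Fintype M1] [Fintype M2] [DecidableEq M1] [DecidableEq M2]
  (P : InputDist V1 V2 X1 X2 X3)

/-- The law of the random codebook. -/
def cbLaw : Codebook M1 M2 V1 V2 X1 X2 X3 → ℝ :=
  prodKernel (piPmf fun _ => P.v1) fun f1 => prodKernel (piPmf fun _ => P.v2) fun f2 =>
    prodKernel (piPmf fun a => P.x1 (f1 a.1)) fun _ =>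
      prodKernel (piPmf fun a => P.x2 (f2 a.1)) fun _ =>
        piPmf fun a => P.x3 (f1 a.1) (f2 a.2)

lemma isPmf_cbLaw : IsPmf (P.cbLaw (M1 := M1) (M2 := M2)) :=
  isPmf_prodKernel (isPmf_piPmf fun _ => P.isPmf_v1) fun f1 =>
    isPmf_prodKernel (isPmf_piPmf fun _ => P.isPmf_v2) fun f2 =>
      isPmf_prodKernel (isPmf_piPmf fun a : M1 × M1 => P.isPmf_x1 (f1 a.1)) fun _ =>
        isPmf_prodKernel (isPmf_piPmf fun a : M2 × M2 => P.isPmf_x2 (f2 a.1)) fun _ =>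
          isPmf_piPmf fun a : M1 × M2 => P.isPmf_x3 (f1 a.1) (f2 a.2)

lemma wsum_cbLaw (F : Codebook M1 M2 V1 V2 X1 X2 X3 → ℝ) :
    wsum P.cbLaw F = wsum (piPmf fun _ => P.v1) fun f1 => wsum (piPmf fun _ => P.v2) fun f2 =>
      wsum (piPmf fun a => P.x1 (f1 a.1)) fun g1 => wsum (piPmf fun a => P.x2 (f2 a.1)) fun g2 =>
        wsum (piPmf fun a => P.x3 (f1 a.1) (f2 a.2)) fun g3 => F (f1, f2, g1, g2, g3) := by
  simp only [cbLaw, wsum_prodKernel]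

lemma wsum_v1_single (a : M1) (F : V1 → ℝ) :
    (wsum (piPmf fun _ : M1 => P.v1) fun f => F (f a)) = wsum P.v1 F :=
  wsum_piPmf_single (fun _ => P.isPmf_v1) a F

lemma wsum_v1_pair {a a' : M1} (h : a ≠ a') (F : V1 → V1 → ℝ) :
    (wsum (piPmf fun _ : M1 => P.v1) fun f => F (f a) (f a')) =
      wsum P.v1 fun v => wsum P.v1 fun v' => F v v' :=
  wsum_piPmf_pair (fun _ => P.isPmf_v1) h F

lemma wsum_v2_single (a : M2) (F : V2 → ℝ) :
    (wsum (piPmf fun _ : M2 => P.v2) fun f => F (f a)) = wsum P.v2 F :=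
  wsum_piPmf_single (fun _ => P.isPmf_v2) a F

lemma wsum_v2_pair {a a' : M2} (h : a ≠ a') (F : V2 → V2 → ℝ) :
    (wsum (piPmf fun _ : M2 => P.v2) fun f => F (f a) (f a')) =
      wsum P.v2 fun v => wsum P.v2 fun v' => F v v' :=
  wsum_piPmf_pair (fun _ => P.isPmf_v2) h F

lemma wsum_x1_single (f : M1 → V1) (a b : M1) (F : X1 → ℝ) :
    (wsum (piPmf fun a : M1 × M1 => P.x1 (f a.1)) fun g => F (g (a, b))) = wsum (P.x1 (f a)) F :=
  wsum_piPmf_single (p := fun a : M1 × M1 => P.x1 (f a.1)) (fun a => P.isPmf_x1 (f a.1)) (a, b) F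

lemma wsum_x1_pair (f : M1 → V1) {i j : M1 × M1} (h : i ≠ j) (F : X1 → X1 → ℝ) :
    (wsum (piPmf fun a : M1 × M1 => P.x1 (f a.1)) fun g => F (g i) (g j)) =
      wsum (P.x1 (f i.1)) fun x => wsum (P.x1 (f j.1)) fun x' => F x x' :=
  wsum_piPmf_pair (p := fun a : M1 × M1 => P.x1 (f a.1)) (fun a => P.isPmf_x1 (f a.1)) h F

lemma wsum_x2_single (f : M2 → V2) (a b : M2) (F : X2 → ℝ) :
    (wsum (piPmf fun a : M2 × M2 => P.x2 (f a.1)) fun g => F (g (a, b))) = wsum (P.x2 (f a)) F :=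
  wsum_piPmf_single (p := fun a : M2 × M2 => P.x2 (f a.1)) (fun a => P.isPmf_x2 (f a.1)) (a, b) F

lemma wsum_x2_pair (f : M2 → V2) {i j : M2 × M2} (h : i ≠ j) (F : X2 → X2 → ℝ) :
    (wsum (piPmf fun a : M2 × M2 => P.x2 (f a.1)) fun g => F (g i) (g j)) =
      wsum (P.x2 (f i.1)) fun x => wsum (P.x2 (f j.1)) fun x' => F x x' :=
  wsum_piPmf_pair (p := fun a : M2 × M2 => P.x2 (f a.1)) (fun a => P.isPmf_x2 (f a.1)) h F

lemma wsum_x3_single (f1 : M1 → V1) (f2 : M2 → V2) (a : M1) (b : M2) (F : X3 → ℝ) :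
    (wsum (piPmf fun a : M1 × M2 => P.x3 (f1 a.1) (f2 a.2)) fun g => F (g (a, b))) =
      wsum (P.x3 (f1 a) (f2 b)) F :=
  wsum_piPmf_single (p := fun a : M1 × M2 => P.x3 (f1 a.1) (f2 a.2))
    (fun a => P.isPmf_x3 (f1 a.1) (f2 a.2)) (a, b) F

lemma wsum_x3_pair (f1 : M1 → V1) (f2 : M2 → V2) {i j : M1 × M2} (h : i ≠ j) (F : X3 → X3 → ℝ) :
    (wsum (piPmf fun a : M1 × M2 => P.x3 (f1 a.1) (f2 a.2)) fun g => F (g i) (g j)) =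
      wsum (P.x3 (f1 i.1) (f2 i.2)) fun x => wsum (P.x3 (f1 j.1) (f2 j.2)) fun x' => F x x' :=
  wsum_piPmf_pair (p := fun a : M1 × M2 => P.x3 (f1 a.1) (f2 a.2))
    (fun a => P.isPmf_x3 (f1 a.1) (f2 a.2)) h F

lemma wsum_cbLaw_letters (a b : M1 × M2) (F : V1 × V2 × X1 × X2 × X3 → ℝ) :
    (wsum P.cbLaw fun c => F (Codebook.letters c a b)) = wsum P.law F := by
  have e3 := fun f1 f2 v1 v2 x1 x2 =>
    P.wsum_x3_single f1 f2 a.1 a.2 fun x3 => F (v1, v2, x1, x2, x3)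
  have e2 := fun f v1 v2 v1' v2' x1 =>
    P.wsum_x2_single f a.2 b.2 fun x2 => wsum (P.x3 v1' v2') fun x3 => F (v1, v2, x1, x2, x3)
  have e1 := fun f v1 v2 v1' v2' v2'' => P.wsum_x1_single f a.1 b.1 fun x1 =>
    wsum (P.x2 v2'') fun x2 => wsum (P.x3 v1' v2') fun x3 => F (v1, v2, x1, x2, x3)
  have ev := fun v1 => P.wsum_v2_single a.2 fun v2 => wsum (P.x1 v1) fun x1 =>
    wsum (P.x2 v2) fun x2 => wsum (P.x3 v1 v2) fun x3 => F (v1, v2, x1, x2, x3)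
  simp only [wsum_cbLaw, wsum_law, Codebook.letters, e3, e2, e1, ev]
  exact P.wsum_v1_single a.1 fun v1 => wsum P.v2 fun v2 =>
    wsum (P.x1 v1) fun x1 => wsum (P.x2 v2) fun x2 => wsum (P.x3 v1 v2) fun x3 =>
      F (v1, v2, x1, x2, x3)

end InputDist

end Codebook

section CodebookPairs

namespace InputDist

variable {M1 M2 : Type} [Fintype M1] [Fintype M2] [DecidableEq M1] [DecidableEq M2]
  (P : InputDist V1 V2 X1 X2 X3)

lemma wsum_cbLaw_fresh_fst {a : M1 × M2} {b1 b1' : M1} (b2 : M2) (h : b1 ≠ b1')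
    (F : V1 × V2 × X1 × X2 × X3 → V1 × V2 × X1 × X2 × X3 → ℝ) :
    (wsum P.cbLaw fun c => F (Codebook.letters c a (b1, b2)) (Codebook.letters c a (b1', b2))) =
      wsum P.law fun u => wsum (P.x1 u.1) fun x1' => F u (u.1, u.2.1, x1', u.2.2.2) := by
  have hne : (a.1, b1) ≠ (a.1, b1') := fun e => h (Prod.ext_iff.1 e).2
  have e3 := fun f1 f2 v1 v2 x1 x1' x2 => P.wsum_x3_single f1 f2 a.1 a.2 fun x3 =>
    F (v1, v2, x1, x2, x3) (v1, v2, x1', x2, x3)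
  have e2 := fun f v1 v2 x1 x1' => P.wsum_x2_single f a.2 b2 fun x2 => wsum (P.x3 v1 v2) fun x3 =>
    F (v1, v2, x1, x2, x3) (v1, v2, x1', x2, x3)
  have e1 := fun f v1 v2 => P.wsum_x1_pair f hne fun x1 x1' => wsum (P.x2 v2) fun x2 =>
    wsum (P.x3 v1 v2) fun x3 => F (v1, v2, x1, x2, x3) (v1, v2, x1', x2, x3)
  have ev := fun v1 => P.wsum_v2_single a.2 fun v2 => wsum (P.x1 v1) fun x1 =>
    wsum (P.x1 v1) fun x1' => wsum (P.x2 v2) fun x2 => wsum (P.x3 v1 v2) fun x3 =>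
      F (v1, v2, x1, x2, x3) (v1, v2, x1', x2, x3)
  simp only [wsum_cbLaw, wsum_law, Codebook.letters, e3, e2, e1, ev]
  refine (P.wsum_v1_single a.1 fun v1 => wsum P.v2 fun v2 => wsum (P.x1 v1) fun x1 =>
    wsum (P.x1 v1) fun x1' => wsum (P.x2 v2) fun x2 => wsum (P.x3 v1 v2) fun x3 =>
      F (v1, v2, x1, x2, x3) (v1, v2, x1', x2, x3)).trans ?_
  refine wsum_congr fun v1 => wsum_congr fun v2 => wsum_congr fun x1 => ?_
  rw [wsum_comm]
  refine wsum_congr fun x2 => ?_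
  rw [wsum_comm]

lemma wsum_cbLaw_fresh_snd {a : M1 × M2} (b1 : M1) {b2 b2' : M2} (h : b2 ≠ b2')
    (F : V1 × V2 × X1 × X2 × X3 → V1 × V2 × X1 × X2 × X3 → ℝ) :
    (wsum P.cbLaw fun c => F (Codebook.letters c a (b1, b2)) (Codebook.letters c a (b1, b2'))) =
      wsum P.law fun u => wsum (P.x2 u.2.1) fun x2' =>
        F u (u.1, u.2.1, u.2.2.1, x2', u.2.2.2.2) := by
  have hne : (a.2, b2) ≠ (a.2, b2') := fun e => h (Prod.ext_iff.1 e).2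
  have e3 := fun f1 f2 v1 v2 x1 x2 x2' => P.wsum_x3_single f1 f2 a.1 a.2 fun x3 =>
    F (v1, v2, x1, x2, x3) (v1, v2, x1, x2', x3)
  have e2 := fun f v1 v2 x1 => P.wsum_x2_pair f hne fun x2 x2' => wsum (P.x3 v1 v2) fun x3 =>
    F (v1, v2, x1, x2, x3) (v1, v2, x1, x2', x3)
  have e1 := fun f v1 v2 => P.wsum_x1_single f a.1 b1 fun x1 => wsum (P.x2 v2) fun x2 =>
    wsum (P.x2 v2) fun x2' => wsum (P.x3 v1 v2) fun x3 =>
      F (v1, v2, x1, x2, x3) (v1, v2, x1, x2', x3)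
  have ev := fun v1 => P.wsum_v2_single a.2 fun v2 => wsum (P.x1 v1) fun x1 =>
    wsum (P.x2 v2) fun x2 => wsum (P.x2 v2) fun x2' => wsum (P.x3 v1 v2) fun x3 =>
      F (v1, v2, x1, x2, x3) (v1, v2, x1, x2', x3)
  simp only [wsum_cbLaw, wsum_law, Codebook.letters, e3, e2, e1, ev]
  refine (P.wsum_v1_single a.1 fun v1 => wsum P.v2 fun v2 => wsum (P.x1 v1) fun x1 =>
    wsum (P.x2 v2) fun x2 => wsum (P.x2 v2) fun x2' => wsum (P.x3 v1 v2) fun x3 =>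
      F (v1, v2, x1, x2, x3) (v1, v2, x1, x2', x3)).trans ?_
  refine wsum_congr fun v1 => wsum_congr fun v2 => wsum_congr fun x1 => wsum_congr fun x2 => ?_
  rw [wsum_comm]

lemma wsum_cbLaw_fresh_both {a b b' : M1 × M2} (h1 : b.1 ≠ b'.1) (h2 : b.2 ≠ b'.2)
    (F : V1 × V2 × X1 × X2 × X3 → V1 × V2 × X1 × X2 × X3 → ℝ) :
    (wsum P.cbLaw fun c => F (Codebook.letters c a b) (Codebook.letters c a b')) =
      wsum P.law fun u => wsum (P.x1 u.1) fun x1' => wsum (P.x2 u.2.1) fun x2' =>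
        F u (u.1, u.2.1, x1', x2', u.2.2.2.2) := by
  have hne1 : (a.1, b.1) ≠ (a.1, b'.1) := fun e => h1 (Prod.ext_iff.1 e).2
  have hne2 : (a.2, b.2) ≠ (a.2, b'.2) := fun e => h2 (Prod.ext_iff.1 e).2
  have e3 := fun f1 f2 v1 v2 x1 x1' x2 x2' => P.wsum_x3_single f1 f2 a.1 a.2 fun x3 =>
    F (v1, v2, x1, x2, x3) (v1, v2, x1', x2', x3)
  have e2 := fun f v1 v2 x1 x1' => P.wsum_x2_pair f hne2 fun x2 x2' => wsum (P.x3 v1 v2) fun x3 =>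
    F (v1, v2, x1, x2, x3) (v1, v2, x1', x2', x3)
  have e1 := fun f v1 v2 => P.wsum_x1_pair f hne1 fun x1 x1' => wsum (P.x2 v2) fun x2 =>
    wsum (P.x2 v2) fun x2' => wsum (P.x3 v1 v2) fun x3 =>
      F (v1, v2, x1, x2, x3) (v1, v2, x1', x2', x3)
  have ev := fun v1 => P.wsum_v2_single a.2 fun v2 => wsum (P.x1 v1) fun x1 =>
    wsum (P.x1 v1) fun x1' => wsum (P.x2 v2) fun x2 => wsum (P.x2 v2) fun x2' =>
      wsum (P.x3 v1 v2) fun x3 => F (v1, v2, x1, x2, x3) (v1, v2, x1', x2', x3)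
  simp only [wsum_cbLaw, wsum_law, Codebook.letters, e3, e2, e1, ev]
  refine (P.wsum_v1_single a.1 fun v1 => wsum P.v2 fun v2 => wsum (P.x1 v1) fun x1 =>
    wsum (P.x1 v1) fun x1' => wsum (P.x2 v2) fun x2 => wsum (P.x2 v2) fun x2' =>
      wsum (P.x3 v1 v2) fun x3 => F (v1, v2, x1, x2, x3) (v1, v2, x1', x2', x3)).trans ?_
  refine wsum_congr fun v1 => wsum_congr fun v2 => wsum_congr fun x1 => ?_
  refine (wsum_comm _ _ _).trans (wsum_congr fun x2 => ?_)
  exact wsum_comm_two _ (fun _ => P.x2 v2) _ _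

lemma wsum_cbLaw_prev_fst {a1 a1' : M1} (a2 : M2) (b : M1 × M2) (h : a1 ≠ a1')
    (F : V1 × V2 × X1 × X2 × X3 → V1 × V2 × X1 × X2 × X3 → ℝ) :
    (wsum P.cbLaw fun c => F (Codebook.letters c (a1, a2) b) (Codebook.letters c (a1', a2) b)) =
      wsum P.law fun u => wsum P.v1 fun v1' => wsum (P.x1 v1') fun x1' =>
        wsum (P.x3 v1' u.2.1) fun x3' => F u (v1', u.2.1, x1', u.2.2.2.1, x3') := by
  have hne1 : (a1, b.1) ≠ (a1', b.1) := fun e => h (Prod.ext_iff.1 e).1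
  have hne3 : (a1, a2) ≠ (a1', a2) := fun e => h (Prod.ext_iff.1 e).1
  have e3 := fun f1 f2 v1 v1' v2 x1 x1' x2 => P.wsum_x3_pair f1 f2 hne3 fun x3 x3' =>
    F (v1, v2, x1, x2, x3) (v1', v2, x1', x2, x3')
  have e2 := fun f v1 v1' v2 x1 x1' => P.wsum_x2_single f a2 b.2 fun x2 =>
    wsum (P.x3 v1 v2) fun x3 => wsum (P.x3 v1' v2) fun x3' =>
      F (v1, v2, x1, x2, x3) (v1', v2, x1', x2, x3')
  have e1 := fun f v1 v1' v2 => P.wsum_x1_pair f hne1 fun x1 x1' => wsum (P.x2 v2) fun x2 =>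
    wsum (P.x3 v1 v2) fun x3 => wsum (P.x3 v1' v2) fun x3' =>
      F (v1, v2, x1, x2, x3) (v1', v2, x1', x2, x3')
  have ev := fun v1 v1' => P.wsum_v2_single a2 fun v2 => wsum (P.x1 v1) fun x1 =>
    wsum (P.x1 v1') fun x1' => wsum (P.x2 v2) fun x2 => wsum (P.x3 v1 v2) fun x3 =>
      wsum (P.x3 v1' v2) fun x3' => F (v1, v2, x1, x2, x3) (v1', v2, x1', x2, x3')
  simp only [wsum_cbLaw, wsum_law, Codebook.letters, e3, e2, e1, ev]
  refine (P.wsum_v1_pair h fun v1 v1' => wsum P.v2 fun v2 => wsum (P.x1 v1) fun x1 =>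
    wsum (P.x1 v1') fun x1' => wsum (P.x2 v2) fun x2 => wsum (P.x3 v1 v2) fun x3 =>
      wsum (P.x3 v1' v2) fun x3' => F (v1, v2, x1, x2, x3) (v1', v2, x1', x2, x3')).trans ?_
  refine wsum_congr fun v1 => ?_
  refine (wsum_comm _ _ _).trans (wsum_congr fun v2 => ?_)
  refine (wsum_comm _ _ _).trans (wsum_congr fun x1 => ?_)
  refine (wsum_comm_two _ P.x1 _ _).trans (wsum_congr fun x2 => ?_)
  exact wsum_comm_two _ P.x1 _ _

lemma wsum_cbLaw_prev_snd (a1 : M1) {a2 a2' : M2} (b : M1 × M2) (h : a2 ≠ a2')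
    (F : V1 × V2 × X1 × X2 × X3 → V1 × V2 × X1 × X2 × X3 → ℝ) :
    (wsum P.cbLaw fun c => F (Codebook.letters c (a1, a2) b) (Codebook.letters c (a1, a2') b)) =
      wsum P.law fun u => wsum P.v2 fun v2' => wsum (P.x2 v2') fun x2' =>
        wsum (P.x3 u.1 v2') fun x3' => F u (u.1, v2', u.2.2.1, x2', x3') := by
  have hne2 : (a2, b.2) ≠ (a2', b.2) := fun e => h (Prod.ext_iff.1 e).1
  have hne3 : (a1, a2) ≠ (a1, a2') := fun e => h (Prod.ext_iff.1 e).2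
  have e3 := fun f1 f2 v1 v2 v2' x1 x2 x2' => P.wsum_x3_pair f1 f2 hne3 fun x3 x3' =>
    F (v1, v2, x1, x2, x3) (v1, v2', x1, x2', x3')
  have e2 := fun f v1 v2 v2' x1 => P.wsum_x2_pair f hne2 fun x2 x2' =>
    wsum (P.x3 v1 v2) fun x3 => wsum (P.x3 v1 v2') fun x3' =>
      F (v1, v2, x1, x2, x3) (v1, v2', x1, x2', x3')
  have e1 := fun f v1 v2 v2' => P.wsum_x1_single f a1 b.1 fun x1 => wsum (P.x2 v2) fun x2 =>
    wsum (P.x2 v2') fun x2' => wsum (P.x3 v1 v2) fun x3 => wsum (P.x3 v1 v2') fun x3' =>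
      F (v1, v2, x1, x2, x3) (v1, v2', x1, x2', x3')
  have ev := fun v1 => P.wsum_v2_pair h fun v2 v2' => wsum (P.x1 v1) fun x1 =>
    wsum (P.x2 v2) fun x2 => wsum (P.x2 v2') fun x2' => wsum (P.x3 v1 v2) fun x3 =>
      wsum (P.x3 v1 v2') fun x3' => F (v1, v2, x1, x2, x3) (v1, v2', x1, x2', x3')
  simp only [wsum_cbLaw, wsum_law, Codebook.letters, e3, e2, e1, ev]
  refine (P.wsum_v1_single a1 fun v1 => wsum P.v2 fun v2 => wsum P.v2 fun v2' =>
    wsum (P.x1 v1) fun x1 => wsum (P.x2 v2) fun x2 => wsum (P.x2 v2') fun x2' =>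
      wsum (P.x3 v1 v2) fun x3 => wsum (P.x3 v1 v2') fun x3' =>
        F (v1, v2, x1, x2, x3) (v1, v2', x1, x2', x3')).trans ?_
  refine wsum_congr fun v1 => wsum_congr fun v2 => ?_
  refine (wsum_comm _ _ _).trans (wsum_congr fun x1 => ?_)
  refine (wsum_comm _ _ _).trans (wsum_congr fun x2 => ?_)
  exact wsum_comm_two _ P.x2 _ _

lemma wsum_cbLaw_prev_both {a a' : M1 × M2} (b : M1 × M2) (h1 : a.1 ≠ a'.1) (h2 : a.2 ≠ a'.2)
    (F : V1 × V2 × X1 × X2 × X3 → V1 × V2 × X1 × X2 × X3 → ℝ) :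
    (wsum P.cbLaw fun c => F (Codebook.letters c a b) (Codebook.letters c a' b)) =
      wsum P.law fun u => wsum P.law fun u' => F u u' := by
  have hne1 : (a.1, b.1) ≠ (a'.1, b.1) := fun e => h1 (Prod.ext_iff.1 e).1
  have hne2 : (a.2, b.2) ≠ (a'.2, b.2) := fun e => h2 (Prod.ext_iff.1 e).1
  have hne3 : (a.1, a.2) ≠ (a'.1, a'.2) := fun e => h1 (Prod.ext_iff.1 e).1
  have e3 := fun f1 f2 v1 v1' v2 v2' x1 x1' x2 x2' => P.wsum_x3_pair f1 f2 hne3 fun x3 x3' =>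
    F (v1, v2, x1, x2, x3) (v1', v2', x1', x2', x3')
  have e2 := fun f v1 v1' v2 v2' x1 x1' => P.wsum_x2_pair f hne2 fun x2 x2' =>
    wsum (P.x3 v1 v2) fun x3 => wsum (P.x3 v1' v2') fun x3' =>
      F (v1, v2, x1, x2, x3) (v1', v2', x1', x2', x3')
  have e1 := fun f v1 v1' v2 v2' => P.wsum_x1_pair f hne1 fun x1 x1' => wsum (P.x2 v2) fun x2 =>
    wsum (P.x2 v2') fun x2' => wsum (P.x3 v1 v2) fun x3 => wsum (P.x3 v1' v2') fun x3' =>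
      F (v1, v2, x1, x2, x3) (v1', v2', x1', x2', x3')
  have ev := fun v1 v1' => P.wsum_v2_pair h2 fun v2 v2' => wsum (P.x1 v1) fun x1 =>
    wsum (P.x1 v1') fun x1' => wsum (P.x2 v2) fun x2 => wsum (P.x2 v2') fun x2' =>
      wsum (P.x3 v1 v2) fun x3 => wsum (P.x3 v1' v2') fun x3' =>
        F (v1, v2, x1, x2, x3) (v1', v2', x1', x2', x3')
  simp only [wsum_cbLaw, wsum_law, Codebook.letters, e3, e2, e1, ev]
  refine (P.wsum_v1_pair h1 fun v1 v1' => wsum P.v2 fun v2 => wsum P.v2 fun v2' =>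
    wsum (P.x1 v1) fun x1 => wsum (P.x1 v1') fun x1' => wsum (P.x2 v2) fun x2 =>
      wsum (P.x2 v2') fun x2' => wsum (P.x3 v1 v2) fun x3 => wsum (P.x3 v1' v2') fun x3' =>
        F (v1, v2, x1, x2, x3) (v1', v2', x1', x2', x3')).trans ?_
  refine wsum_congr fun v1 => ?_
  refine (wsum_comm _ _ _).trans (wsum_congr fun v2 => ?_)
  refine (wsum_comm_two _ (fun _ => P.v2) _ _).trans (wsum_congr fun x1 => ?_)
  refine (wsum_comm_three _ (fun _ => P.v2) (fun v1 _ => P.x1 v1) _ _).trans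
    (wsum_congr fun x2 => ?_)
  exact wsum_comm_four _ (fun _ => P.v2) (fun v1 _ => P.x1 v1) (fun _ v2 _ => P.x2 v2) _ _

end InputDist

end CodebookPairs

/-! ### Channel outputs and decoding metrics -/

section Metrics

namespace InputDist

variable (P : InputDist V1 V2 X1 X2 X3) (ch : DMMARC X1 X2 X3 Y Y3)

/-- The law of `(V1, V2, X1, X2, X3, Y, Y3)`. -/
def outLaw : V1 × V2 × X1 × X2 × X3 × Y × Y3 → ℝ :=
  prodKernel P.v1 fun v1 => prodKernel P.v2 fun v2 => prodKernel (P.x1 v1) fun x1 =>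
    prodKernel (P.x2 v2) fun x2 => prodKernel (P.x3 v1 v2) fun x3 => chan ch x1 x2 x3

lemma isPmf_outLaw : IsPmf (P.outLaw ch) :=
  isPmf_prodKernel P.isPmf_v1 fun v1 => isPmf_prodKernel P.isPmf_v2 fun v2 =>
    isPmf_prodKernel (P.isPmf_x1 v1) fun _ => isPmf_prodKernel (P.isPmf_x2 v2) fun _ =>
      isPmf_prodKernel (P.isPmf_x3 v1 v2) fun _ => isPmf_chan ch _ _ _

lemma wsum_outLaw (F : V1 × V2 × X1 × X2 × X3 × Y × Y3 → ℝ) :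
    wsum (P.outLaw ch) F = wsum P.law fun u =>
      wsum (chan ch u.2.2.1 u.2.2.2.1 u.2.2.2.2) fun o =>
        F (u.1, u.2.1, u.2.2.1, u.2.2.2.1, u.2.2.2.2, o) := by
  simp only [outLaw, wsum_law, wsum_prodKernel]

lemma wsum_outLaw_of_inputs (F : V1 × V2 × X1 × X2 × X3 → ℝ) :
    (wsum (P.outLaw ch) fun z => F (z.1, z.2.1, z.2.2.1, z.2.2.2.1, z.2.2.2.2.1)) =
      wsum P.law F := by
  rw [wsum_outLaw]
  exact wsum_congr fun u => wsum_const (isPmf_chan ch _ _ _) (F u)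

/-- The information ratio of `I(X1; Y3 | X2, V1, X3)`. -/
def relayRatioFst (u : V1 × V2 × X1 × X2 × X3) (o : Y3) : ℝ :=
  infoRatio (P.outLaw ch) (fun z => z.2.2.1) (fun z => z.2.2.2.2.2.2)
    (fun z => (z.2.2.2.1, z.1, z.2.2.2.2.1)) u.2.2.1 o (u.2.2.2.1, u.1, u.2.2.2.2)

/-- The information ratio of `I(X2; Y3 | X1, V2, X3)`. -/
def relayRatioSnd (u : V1 × V2 × X1 × X2 × X3) (o : Y3) : ℝ :=
  infoRatio (P.outLaw ch) (fun z => z.2.2.2.1) (fun z => z.2.2.2.2.2.2)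
    (fun z => (z.2.2.1, z.2.1, z.2.2.2.2.1)) u.2.2.2.1 o (u.2.2.1, u.2.1, u.2.2.2.2)

/-- The information ratio of `I(X1, X2; Y3 | V1, V2, X3)`. -/
def relayRatioBoth (u : V1 × V2 × X1 × X2 × X3) (o : Y3) : ℝ :=
  infoRatio (P.outLaw ch) (fun z => (z.2.2.1, z.2.2.2.1)) (fun z => z.2.2.2.2.2.2)
    (fun z => (z.1, z.2.1, z.2.2.2.2.1)) (u.2.2.1, u.2.2.2.1) o (u.1, u.2.1, u.2.2.2.2)

/-- The information ratio of `I(X1, X3; Y | X2, V2)`. -/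
def destRatioFst (u : V1 × V2 × X1 × X2 × X3) (o : Y) : ℝ :=
  infoRatio (P.outLaw ch) (fun z => (z.2.2.1, z.2.2.2.2.1)) (fun z => z.2.2.2.2.2.1)
    (fun z => (z.2.2.2.1, z.2.1)) (u.2.2.1, u.2.2.2.2) o (u.2.2.2.1, u.2.1)

/-- The information ratio of `I(X2, X3; Y | X1, V1)`. -/
def destRatioSnd (u : V1 × V2 × X1 × X2 × X3) (o : Y) : ℝ :=
  infoRatio (P.outLaw ch) (fun z => (z.2.2.2.1, z.2.2.2.2.1)) (fun z => z.2.2.2.2.2.1)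
    (fun z => (z.2.2.1, z.1)) (u.2.2.2.1, u.2.2.2.2) o (u.2.2.1, u.1)

/-- The information ratio of `I(X1, X2, X3; Y)`. -/
def destRatioBoth (u : V1 × V2 × X1 × X2 × X3) (o : Y) : ℝ :=
  infoRatio (P.outLaw ch) (fun z => (z.2.2.1, z.2.2.2.1, z.2.2.2.2.1)) (fun z => z.2.2.2.2.2.1)
    (fun _ => ()) (u.2.2.1, u.2.2.2.1, u.2.2.2.2) o ()

/-- The three decoding metrics of the relay. -/
def relayRatio : Fin 3 → V1 × V2 × X1 × X2 × X3 → Y3 → ℝ :=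
  ![P.relayRatioFst ch, P.relayRatioSnd ch, P.relayRatioBoth ch]

/-- The three decoding metrics of the destination. -/
def destRatio : Fin 3 → V1 × V2 × X1 × X2 × X3 → Y → ℝ :=
  ![P.destRatioFst ch, P.destRatioSnd ch, P.destRatioBoth ch]

/-- The law of the relay output for given letters. -/
def relayOut (u : V1 × V2 × X1 × X2 × X3) : Y3 → ℝ :=
  pr (chan ch u.2.2.1 u.2.2.2.1 u.2.2.2.2) Prod.snd

/-- The law of the destination output for given letters. -/
def destOut (u : V1 × V2 × X1 × X2 × X3) : Y → ℝ :=
  pr (chan ch u.2.2.1 u.2.2.2.1 u.2.2.2.2) Prod.fst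

lemma wsum_law_relayOut (F : V1 × V2 × X1 × X2 × X3 → Y3 → ℝ) :
    (wsum P.law fun u => wsum (relayOut ch u) fun o => F u o) = wsum (P.outLaw ch) fun z =>
      F (z.1, z.2.1, z.2.2.1, z.2.2.2.1, z.2.2.2.2.1) z.2.2.2.2.2.2 := by
  simp only [wsum_outLaw, relayOut, wsum_pr]

lemma wsum_law_destOut (F : V1 × V2 × X1 × X2 × X3 → Y → ℝ) :
    (wsum P.law fun u => wsum (destOut ch u) fun o => F u o) = wsum (P.outLaw ch) fun z =>
      F (z.1, z.2.1, z.2.2.1, z.2.2.2.1, z.2.2.2.2.1) z.2.2.2.2.2.1 := by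
  simp only [wsum_outLaw, destOut, wsum_pr]

lemma wsum_relayRatioFst_le_one :
    (wsum P.law fun u => wsum (P.x1 u.1) fun x1 => wsum (relayOut ch u) fun o =>
      P.relayRatioFst ch (u.1, u.2.1, x1, u.2.2.2) o) ≤ 1 := by
  refine le_of_eq_of_le ?_ (wsum_infoRatio_le_one (P.isPmf_outLaw ch) (fun z => z.2.2.1)
    (fun z => z.2.2.2.2.2.2) (fun z => (z.2.2.2.1, z.1, z.2.2.2.2.1)) (fun t => P.x1 t.2.1) ?_)
  · refine (wsum_congr fun u => wsum_comm _ _ _).trans ?_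
    exact P.wsum_law_relayOut ch fun u o => wsum (P.x1 u.1) fun x1 =>
      P.relayRatioFst ch (u.1, u.2.1, x1, u.2.2.2) o
  · intro F
    refine (P.wsum_outLaw_of_inputs ch fun u => F u.2.2.1 (u.2.2.2.1, u.1, u.2.2.2.2)).trans
      (.trans ?_ (P.wsum_outLaw_of_inputs ch fun u => wsum (P.x1 u.1) fun x1 =>
        F x1 (u.2.2.2.1, u.1, u.2.2.2.2)).symm)
    simp only [wsum_law]
    refine wsum_congr fun v1 => wsum_congr fun v2 => ?_
    rw [wsum_const (P.isPmf_x1 v1), wsum_comm]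
    exact wsum_congr fun x2 => wsum_comm _ _ _

lemma wsum_relayRatioSnd_le_one :
    (wsum P.law fun u => wsum (P.x2 u.2.1) fun x2 => wsum (relayOut ch u) fun o =>
      P.relayRatioSnd ch (u.1, u.2.1, u.2.2.1, x2, u.2.2.2.2) o) ≤ 1 := by
  refine le_of_eq_of_le ?_ (wsum_infoRatio_le_one (P.isPmf_outLaw ch) (fun z => z.2.2.2.1)
    (fun z => z.2.2.2.2.2.2) (fun z => (z.2.2.1, z.2.1, z.2.2.2.2.1)) (fun t => P.x2 t.2.1) ?_)
  · refine (wsum_congr fun u => wsum_comm _ _ _).trans ?_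
    exact P.wsum_law_relayOut ch fun u o => wsum (P.x2 u.2.1) fun x2 =>
      P.relayRatioSnd ch (u.1, u.2.1, u.2.2.1, x2, u.2.2.2.2) o
  · intro F
    refine (P.wsum_outLaw_of_inputs ch fun u => F u.2.2.2.1 (u.2.2.1, u.2.1, u.2.2.2.2)).trans
      (.trans ?_ (P.wsum_outLaw_of_inputs ch fun u => wsum (P.x2 u.2.1) fun x2 =>
        F x2 (u.2.2.1, u.2.1, u.2.2.2.2)).symm)
    simp only [wsum_law]
    refine wsum_congr fun v1 => wsum_congr fun v2 => wsum_congr fun x1 => ?_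
    rw [wsum_const (P.isPmf_x2 v2), wsum_comm]

lemma wsum_relayRatioBoth_le_one :
    (wsum P.law fun u => wsum (P.x1 u.1) fun x1 => wsum (P.x2 u.2.1) fun x2 =>
      wsum (relayOut ch u) fun o =>
        P.relayRatioBoth ch (u.1, u.2.1, x1, x2, u.2.2.2.2) o) ≤ 1 := by
  refine le_of_eq_of_le ?_ (wsum_infoRatio_le_one (P.isPmf_outLaw ch)
    (fun z => (z.2.2.1, z.2.2.2.1)) (fun z => z.2.2.2.2.2.2) (fun z => (z.1, z.2.1, z.2.2.2.2.1))
    (fun t => prodKernel (P.x1 t.1) fun _ => P.x2 t.2.1) ?_)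
  · have e := fun u : V1 × V2 × X1 × X2 × X3 => wsum_comm_two (P.x1 u.1) (fun _ => P.x2 u.2.1)
      (relayOut ch u) fun x1 x2 o => P.relayRatioBoth ch (u.1, u.2.1, x1, x2, u.2.2.2.2) o
    simp only [wsum_prodKernel, e]
    exact P.wsum_law_relayOut ch fun u o => wsum (P.x1 u.1) fun x1 => wsum (P.x2 u.2.1) fun x2 =>
      P.relayRatioBoth ch (u.1, u.2.1, x1, x2, u.2.2.2.2) o
  · intro F
    simp only [wsum_prodKernel]
    refine (P.wsum_outLaw_of_inputs ch fun u =>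
      F (u.2.2.1, u.2.2.2.1) (u.1, u.2.1, u.2.2.2.2)).trans
      (.trans ?_ (P.wsum_outLaw_of_inputs ch fun u => wsum (P.x1 u.1) fun x1 =>
        wsum (P.x2 u.2.1) fun x2 => F (x1, x2) (u.1, u.2.1, u.2.2.2.2)).symm)
    simp only [wsum_law]
    refine wsum_congr fun v1 => wsum_congr fun v2 => ?_
    rw [wsum_const (P.isPmf_x1 v1), wsum_const (P.isPmf_x2 v2)]
    exact wsum_comm_two _ (fun _ => P.x2 v2) _ _

lemma wsum_destRatioFst_le_one :
    (wsum P.law fun u => wsum P.v1 fun v1 => wsum (P.x1 v1) fun x1 => wsum (P.x3 v1 u.2.1) fun x3 =>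
      wsum (destOut ch u) fun o =>
        P.destRatioFst ch (v1, u.2.1, x1, u.2.2.2.1, x3) o) ≤ 1 := by
  refine le_of_eq_of_le ?_ (wsum_infoRatio_le_one (P.isPmf_outLaw ch)
    (fun z => (z.2.2.1, z.2.2.2.2.1)) (fun z => z.2.2.2.2.2.1) (fun z => (z.2.2.2.1, z.2.1))
    (fun t => pr (prodKernel P.v1 fun v1 => prodKernel (P.x1 v1) fun _ => P.x3 v1 t.2) Prod.snd) ?_)
  · have e := fun u : V1 × V2 × X1 × X2 × X3 => wsum_comm_three P.v1 P.x1
      (fun v1 _ => P.x3 v1 u.2.1) (destOut ch u) fun v1 x1 x3 o =>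
        P.destRatioFst ch (v1, u.2.1, x1, u.2.2.2.1, x3) o
    simp only [wsum_pr, wsum_prodKernel, e]
    exact P.wsum_law_destOut ch fun u o => wsum P.v1 fun v1 => wsum (P.x1 v1) fun x1 =>
      wsum (P.x3 v1 u.2.1) fun x3 => P.destRatioFst ch (v1, u.2.1, x1, u.2.2.2.1, x3) o
  · intro F
    simp only [wsum_pr, wsum_prodKernel]
    refine (P.wsum_outLaw_of_inputs ch fun u =>
      F (u.2.2.1, u.2.2.2.2) (u.2.2.2.1, u.2.1)).trans
      (.trans ?_ (P.wsum_outLaw_of_inputs ch fun u => wsum P.v1 fun v1 => wsum (P.x1 v1) fun x1 =>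
        wsum (P.x3 v1 u.2.1) fun x3 => F (x1, x3) (u.2.2.2.1, u.2.1)).symm)
    simp only [wsum_law, wsum_const P.isPmf_v1, wsum_const (P.isPmf_x1 _),
      wsum_const (P.isPmf_x3 _ _)]
    refine (wsum_comm _ _ _).trans (wsum_congr fun v2 => ?_)
    exact wsum_comm_two _ P.x1 _ _

lemma wsum_destRatioSnd_le_one :
    (wsum P.law fun u => wsum P.v2 fun v2 => wsum (P.x2 v2) fun x2 => wsum (P.x3 u.1 v2) fun x3 =>
      wsum (destOut ch u) fun o =>
        P.destRatioSnd ch (u.1, v2, u.2.2.1, x2, x3) o) ≤ 1 := by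
  refine le_of_eq_of_le ?_ (wsum_infoRatio_le_one (P.isPmf_outLaw ch)
    (fun z => (z.2.2.2.1, z.2.2.2.2.1)) (fun z => z.2.2.2.2.2.1) (fun z => (z.2.2.1, z.1))
    (fun t => pr (prodKernel P.v2 fun v2 => prodKernel (P.x2 v2) fun _ => P.x3 t.2 v2) Prod.snd) ?_)
  · have e := fun u : V1 × V2 × X1 × X2 × X3 => wsum_comm_three P.v2 P.x2
      (fun v2 _ => P.x3 u.1 v2) (destOut ch u) fun v2 x2 x3 o =>
        P.destRatioSnd ch (u.1, v2, u.2.2.1, x2, x3) o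
    simp only [wsum_pr, wsum_prodKernel, e]
    exact P.wsum_law_destOut ch fun u o => wsum P.v2 fun v2 => wsum (P.x2 v2) fun x2 =>
      wsum (P.x3 u.1 v2) fun x3 => P.destRatioSnd ch (u.1, v2, u.2.2.1, x2, x3) o
  · intro F
    simp only [wsum_pr, wsum_prodKernel]
    refine (P.wsum_outLaw_of_inputs ch fun u =>
      F (u.2.2.2.1, u.2.2.2.2) (u.2.2.1, u.1)).trans
      (.trans ?_ (P.wsum_outLaw_of_inputs ch fun u => wsum P.v2 fun v2 => wsum (P.x2 v2) fun x2 =>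
        wsum (P.x3 u.1 v2) fun x3 => F (x2, x3) (u.2.2.1, u.1)).symm)
    simp only [wsum_law, wsum_const P.isPmf_v2, wsum_const (P.isPmf_x2 _),
      wsum_const (P.isPmf_x3 _ _)]
    exact wsum_congr fun v1 => wsum_comm _ _ _

lemma wsum_destRatioBoth_le_one :
    (wsum P.law fun u => wsum P.law fun u' => wsum (destOut ch u) fun o =>
      P.destRatioBoth ch u' o) ≤ 1 := by
  refine le_of_eq_of_le ?_ (wsum_infoRatio_le_one (P.isPmf_outLaw ch)
    (fun z => (z.2.2.1, z.2.2.2.1, z.2.2.2.2.1)) (fun z => z.2.2.2.2.2.1) (fun _ => ())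
    (fun _ => pr P.law fun u => u.2.2) ?_)
  · refine (wsum_congr fun u => wsum_comm _ _ _).trans ?_
    simp only [wsum_pr]
    exact P.wsum_law_destOut ch fun _ o => wsum P.law fun u' => P.destRatioBoth ch u' o
  · intro F
    simp only [wsum_pr]
    rw [wsum_const (P.isPmf_outLaw ch)]
    exact P.wsum_outLaw_of_inputs ch fun u => F u.2.2 ()

variable {M1 M2 : Type} [Fintype M1] [Fintype M2] [DecidableEq M1] [DecidableEq M2]

lemma wsum_relayRatio_wrong (j : Fin 3) (a b b' : M1 × M2) (h : differs j b b') :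
    (wsum P.cbLaw fun c => wsum (relayOut ch (Codebook.letters c a b)) fun o =>
      P.relayRatio ch j (Codebook.letters c a b') o) ≤ 1 := by
  obtain ⟨b1, b2⟩ := b
  obtain ⟨b1', b2'⟩ := b'
  fin_cases j
  · obtain ⟨h1, rfl⟩ : b1' ≠ b1 ∧ b2' = b2 := h
    exact (P.wsum_cbLaw_fresh_fst b2' h1.symm fun u u' => wsum (relayOut ch u) fun o =>
      P.relayRatioFst ch u' o).trans_le (P.wsum_relayRatioFst_le_one ch)
  · obtain ⟨rfl, h2⟩ : b1' = b1 ∧ b2' ≠ b2 := h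
    exact (P.wsum_cbLaw_fresh_snd b1' h2.symm fun u u' => wsum (relayOut ch u) fun o =>
      P.relayRatioSnd ch u' o).trans_le (P.wsum_relayRatioSnd_le_one ch)
  · obtain ⟨h1, h2⟩ : b1' ≠ b1 ∧ b2' ≠ b2 := h
    exact (P.wsum_cbLaw_fresh_both (b := (b1, b2)) (b' := (b1', b2')) h1.symm h2.symm
      fun u u' => wsum (relayOut ch u) fun o =>
        P.relayRatioBoth ch u' o).trans_le (P.wsum_relayRatioBoth_le_one ch)

lemma wsum_destRatio_wrong (j : Fin 3) (b a a' : M1 × M2) (h : differs j a a') :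
    (wsum P.cbLaw fun c => wsum (destOut ch (Codebook.letters c a b)) fun o =>
      P.destRatio ch j (Codebook.letters c a' b) o) ≤ 1 := by
  obtain ⟨a1, a2⟩ := a
  obtain ⟨a1', a2'⟩ := a'
  fin_cases j
  · obtain ⟨h1, rfl⟩ : a1' ≠ a1 ∧ a2' = a2 := h
    exact (P.wsum_cbLaw_prev_fst a2' b h1.symm fun u u' => wsum (destOut ch u) fun o =>
      P.destRatioFst ch u' o).trans_le (P.wsum_destRatioFst_le_one ch)
  · obtain ⟨rfl, h2⟩ : a1' = a1 ∧ a2' ≠ a2 := h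
    exact (P.wsum_cbLaw_prev_snd a1' b h2.symm fun u u' => wsum (destOut ch u) fun o =>
      P.destRatioSnd ch u' o).trans_le (P.wsum_destRatioSnd_le_one ch)
  · obtain ⟨h1, h2⟩ : a1' ≠ a1 ∧ a2' ≠ a2 := h
    exact (P.wsum_cbLaw_prev_both (a := (a1, a2)) (a' := (a1', a2')) b h1.symm h2.symm
      fun u u' => wsum (destOut ch u) fun o =>
        P.destRatioBoth ch u' o).trans_le (P.wsum_destRatioBoth_le_one ch)

end InputDist

end Metrics

section SourceMetric

variable {S A1 A2 D : Type*} [Fintype S] [Fintype A1] [Fintype A2] [Fintype D]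

/-- The conditional probabilities used to weigh source blocks against the side information: of the
first source, of the second source, and of both. -/
def srcMetric {S A1 A2 D : Type*} [Fintype S] (q : S → ℝ) (p1 : S → A1) (p2 : S → A2)
    (pd : S → D) : Fin 3 → A1 → A2 → D → ℝ :=
  ![fun s1 s2 w => condPr q p1 (fun s => (p2 s, pd s)) s1 (s2, w),
    fun s1 s2 w => condPr q p2 (fun s => (p1 s, pd s)) s2 (s1, w),
    fun s1 s2 w => condPr q (fun s => (p1 s, p2 s)) pd (s1, s2) w]

/-- The conditional entropies attached to `srcMetric`. -/
def srcEnt (q : S → ℝ) (p1 : S → A1) (p2 : S → A2) (pd : S → D) : Fin 3 → ℝ :=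
  ![condEnt q p1 fun s => (p2 s, pd s), condEnt q p2 fun s => (p1 s, pd s),
    condEnt q (fun s => (p1 s, p2 s)) pd]

lemma srcMetric_nonneg {A1 A2 D : Type*} {q : S → ℝ} (hq : IsPmf q) (p1 : S → A1) (p2 : S → A2)
    (pd : S → D) (j : Fin 3) (s1 : A1) (s2 : A2) (w : D) : 0 ≤ srcMetric q p1 p2 pd j s1 s2 w := by
  fin_cases j <;> exact condPr_nonneg hq.nonneg _ _ _ _

lemma srcMetric_pos {A1 A2 D : Type*} {q : S → ℝ} (hq : IsPmf q) (p1 : S → A1) (p2 : S → A2)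
    (pd : S → D) (j : Fin 3) (s : S) (hs : 0 < q s) :
    0 < srcMetric q p1 p2 pd j (p1 s) (p2 s) (pd s) := by
  fin_cases j
  · exact condPr_pos hq.nonneg p1 (fun s => (p2 s, pd s)) hs
  · exact condPr_pos hq.nonneg p2 (fun s => (p1 s, pd s)) hs
  · exact condPr_pos hq.nonneg (fun s => (p1 s, p2 s)) pd hs

lemma sum_srcMetric_zero_le_one {A2 D : Type*} (q : S → ℝ) (p1 : S → A1) (p2 : S → A2)
    (pd : S → D) (s2 : A2) (w : D) : ∑ s1, srcMetric q p1 p2 pd 0 s1 s2 w ≤ 1 :=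
  sum_condPr_le_one q p1 (fun s => (p2 s, pd s)) (s2, w)

lemma sum_srcMetric_one_le_one {A1 D : Type*} (q : S → ℝ) (p1 : S → A1) (p2 : S → A2)
    (pd : S → D) (s1 : A1) (w : D) : ∑ s2, srcMetric q p1 p2 pd 1 s1 s2 w ≤ 1 :=
  sum_condPr_le_one q p2 (fun s => (p1 s, pd s)) (s1, w)

lemma sum_srcMetric_two_le_one {D : Type*} (q : S → ℝ) (p1 : S → A1) (p2 : S → A2)
    (pd : S → D) (w : D) : ∑ s : A1 × A2, srcMetric q p1 p2 pd 2 s.1 s.2 w ≤ 1 :=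
  sum_condPr_le_one q (fun s => (p1 s, p2 s)) pd w

lemma wsum_log_srcMetric {q : S → ℝ} (hq : IsPmf q) (p1 : S → A1) (p2 : S → A2)
    (pd : S → D) (j : Fin 3) :
    (wsum q fun s => Real.log (srcMetric q p1 p2 pd j (p1 s) (p2 s) (pd s))) =
      -(srcEnt q p1 p2 pd j * Real.log 2) := by
  fin_cases j
  · exact wsum_log_condPr hq.nonneg p1 fun s => (p2 s, pd s)
  · exact wsum_log_condPr hq.nonneg p2 fun s => (p1 s, pd s)
  · exact wsum_log_condPr hq.nonneg (fun s => (p1 s, p2 s)) pd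

end SourceMetric

section ChannelMetric

namespace InputDist

variable (P : InputDist V1 V2 X1 X2 X3) (ch : DMMARC X1 X2 X3 Y Y3)

/-- The mutual informations attached to `relayRatio`. -/
def relayInfo : Fin 3 → ℝ :=
  ![condMutInfo (P.outLaw ch) (fun z => z.2.2.1) (fun z => z.2.2.2.2.2.2)
      (fun z => (z.2.2.2.1, z.1, z.2.2.2.2.1)),
    condMutInfo (P.outLaw ch) (fun z => z.2.2.2.1) (fun z => z.2.2.2.2.2.2)
      (fun z => (z.2.2.1, z.2.1, z.2.2.2.2.1)),
    condMutInfo (P.outLaw ch) (fun z => (z.2.2.1, z.2.2.2.1)) (fun z => z.2.2.2.2.2.2)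
      (fun z => (z.1, z.2.1, z.2.2.2.2.1))]

/-- The mutual informations attached to `destRatio`. -/
def destInfo : Fin 3 → ℝ :=
  ![condMutInfo (P.outLaw ch) (fun z => (z.2.2.1, z.2.2.2.2.1)) (fun z => z.2.2.2.2.2.1)
      (fun z => (z.2.2.2.1, z.2.1)),
    condMutInfo (P.outLaw ch) (fun z => (z.2.2.2.1, z.2.2.2.2.1)) (fun z => z.2.2.2.2.2.1)
      (fun z => (z.2.2.1, z.1)),
    condMutInfo (P.outLaw ch) (fun z => (z.2.2.1, z.2.2.2.1, z.2.2.2.2.1))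
      (fun z => z.2.2.2.2.2.1) (fun _ => ())]

lemma relayRatio_nonneg (j : Fin 3) (u : V1 × V2 × X1 × X2 × X3) (o : Y3) :
    0 ≤ P.relayRatio ch j u o := by
  fin_cases j <;> exact infoRatio_nonneg (P.isPmf_outLaw ch).nonneg _ _ _ _ _ _

lemma destRatio_nonneg (j : Fin 3) (u : V1 × V2 × X1 × X2 × X3) (o : Y) :
    0 ≤ P.destRatio ch j u o := by
  fin_cases j <;> exact infoRatio_nonneg (P.isPmf_outLaw ch).nonneg _ _ _ _ _ _

lemma relayRatio_outLaw_pos (j : Fin 3) (z : V1 × V2 × X1 × X2 × X3 × Y × Y3)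
    (hz : 0 < P.outLaw ch z) :
    0 < P.relayRatio ch j (z.1, z.2.1, z.2.2.1, z.2.2.2.1, z.2.2.2.2.1) z.2.2.2.2.2.2 := by
  fin_cases j <;> exact infoRatio_pos (P.isPmf_outLaw ch).nonneg _ _ _ hz

lemma destRatio_outLaw_pos (j : Fin 3) (z : V1 × V2 × X1 × X2 × X3 × Y × Y3)
    (hz : 0 < P.outLaw ch z) :
    0 < P.destRatio ch j (z.1, z.2.1, z.2.2.1, z.2.2.2.1, z.2.2.2.2.1) z.2.2.2.2.2.1 := by
  fin_cases j <;> exact infoRatio_pos (P.isPmf_outLaw ch).nonneg _ _ _ hz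

lemma outLaw_eq (u : V1 × V2 × X1 × X2 × X3) (o : Y × Y3) :
    P.outLaw ch (u.1, u.2.1, u.2.2.1, u.2.2.2.1, u.2.2.2.2, o) =
      P.law u * chan ch u.2.2.1 u.2.2.2.1 u.2.2.2.2 o := by
  simp only [outLaw, law, prodKernel]
  ring

lemma relayRatio_pos (j : Fin 3) (u : V1 × V2 × X1 × X2 × X3) (o : Y3) (hu : 0 < P.law u)
    (ho : 0 < relayOut ch u o) : 0 < P.relayRatio ch j u o := by
  obtain ⟨p, -, hp⟩ := Finset.exists_lt_of_sum_lt (s := Finset.univ) (f := fun _ => (0 : ℝ))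
    (by simpa [relayOut, pr] using ho)
  split_ifs at hp with h
  · subst h
    exact P.relayRatio_outLaw_pos ch j (u.1, u.2.1, u.2.2.1, u.2.2.2.1, u.2.2.2.2, p)
      (by rw [outLaw_eq]; exact mul_pos hu hp)
  · exact absurd hp (lt_irrefl _)

lemma destRatio_pos (j : Fin 3) (u : V1 × V2 × X1 × X2 × X3) (o : Y) (hu : 0 < P.law u)
    (ho : 0 < destOut ch u o) : 0 < P.destRatio ch j u o := by
  obtain ⟨p, -, hp⟩ := Finset.exists_lt_of_sum_lt (s := Finset.univ) (f := fun _ => (0 : ℝ))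
    (by simpa [destOut, pr] using ho)
  split_ifs at hp with h
  · subst h
    exact P.destRatio_outLaw_pos ch j (u.1, u.2.1, u.2.2.1, u.2.2.2.1, u.2.2.2.2, p)
      (by rw [outLaw_eq]; exact mul_pos hu hp)
  · exact absurd hp (lt_irrefl _)

lemma wsum_log_relayRatio (j : Fin 3) :
    (wsum (P.outLaw ch) fun z => Real.log (P.relayRatio ch j
      (z.1, z.2.1, z.2.2.1, z.2.2.2.1, z.2.2.2.2.1) z.2.2.2.2.2.2)) =
      P.relayInfo ch j * Real.log 2 := by
  fin_cases j <;> exact wsum_log_infoRatio (P.isPmf_outLaw ch).nonneg _ _ _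

lemma wsum_log_destRatio (j : Fin 3) :
    (wsum (P.outLaw ch) fun z => Real.log (P.destRatio ch j
      (z.1, z.2.1, z.2.2.1, z.2.2.2.1, z.2.2.2.2.1) z.2.2.2.2.2.1)) =
      P.destInfo ch j * Real.log 2 := by
  fin_cases j <;> exact wsum_log_infoRatio (P.isPmf_outLaw ch).nonneg _ _ _

end InputDist

end ChannelMetric

/-! ### Random coding -/

section Moments

/-- The moment of order `-t` of the source metric. -/
def srcMoment {S A1 A2 D : Type*} [Fintype S] (q : S → ℝ) (p1 : S → A1) (p2 : S → A2)
    (pd : S → D) (j : Fin 3) (t : ℝ) : ℝ :=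
  wsum q fun s => srcMetric q p1 p2 pd j (p1 s) (p2 s) (pd s) ^ (-t)

lemma srcMoment_nonneg {S A1 A2 D : Type*} [Fintype S] {q : S → ℝ} (hq : IsPmf q) (p1 : S → A1)
    (p2 : S → A2) (pd : S → D) (j : Fin 3) (t : ℝ) : 0 ≤ srcMoment q p1 p2 pd j t :=
  wsum_nonneg hq.nonneg fun _ => Real.rpow_nonneg (srcMetric_nonneg hq _ _ _ _ _ _ _) _

lemma srcMoment_le {S A1 A2 D : Type*} [Fintype S] [Fintype A1] [Fintype A2] [Fintype D]
    {q : S → ℝ} (hq : IsPmf q) (p1 : S → A1) (p2 : S → A2) (pd : S → D) (j : Fin 3) (ε : ℝ)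
    (hε : 0 < ε) : ∀ᶠ t in nhdsWithin 0 (Set.Ioi 0),
      srcMoment q p1 p2 pd j t ≤ Real.exp (t * (srcEnt q p1 p2 pd j * Real.log 2 + ε)) := by
  filter_upwards [wsum_rpow_neg_le hq (srcMetric_pos hq p1 p2 pd j) hε] with t ht
  refine ht.trans_eq ?_
  rw [wsum_log_srcMetric hq]
  congr 1
  ring

namespace InputDist

variable (P : InputDist V1 V2 X1 X2 X3) (ch : DMMARC X1 X2 X3 Y Y3)

/-- The moment of order `-t` of the relay metric. -/
def relayMoment (j : Fin 3) (t : ℝ) : ℝ :=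
  wsum P.law fun u => wsum (relayOut ch u) fun o => P.relayRatio ch j u o ^ (-t)

/-- The moment of order `-t` of the destination metric. -/
def destMoment (j : Fin 3) (t : ℝ) : ℝ :=
  wsum P.law fun u => wsum (destOut ch u) fun o => P.destRatio ch j u o ^ (-t)

lemma isPmf_relayOut {U1 U2 : Type} (u : U1 × U2 × X1 × X2 × X3) : IsPmf (relayOut ch u) :=
  isPmf_pr (isPmf_chan ch _ _ _) _

lemma isPmf_destOut {U1 U2 : Type} (u : U1 × U2 × X1 × X2 × X3) : IsPmf (destOut ch u) :=
  isPmf_pr (isPmf_chan ch _ _ _) _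

lemma relayMoment_nonneg (j : Fin 3) (t : ℝ) : 0 ≤ P.relayMoment ch j t :=
  wsum_nonneg P.isPmf_law.nonneg fun u => wsum_nonneg (isPmf_relayOut ch u).nonneg fun _ =>
    Real.rpow_nonneg (P.relayRatio_nonneg ch _ _ _) _

lemma destMoment_nonneg (j : Fin 3) (t : ℝ) : 0 ≤ P.destMoment ch j t :=
  wsum_nonneg P.isPmf_law.nonneg fun u => wsum_nonneg (isPmf_destOut ch u).nonneg fun _ =>
    Real.rpow_nonneg (P.destRatio_nonneg ch _ _ _) _

lemma relayMoment_le (j : Fin 3) (ε : ℝ) (hε : 0 < ε) : ∀ᶠ t in nhdsWithin 0 (Set.Ioi 0),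
    P.relayMoment ch j t ≤ Real.exp (-t * (P.relayInfo ch j * Real.log 2 - ε)) := by
  filter_upwards [wsum_rpow_neg_le (P.isPmf_outLaw ch) (P.relayRatio_outLaw_pos ch j) hε]
    with t ht
  rw [wsum_log_relayRatio] at ht
  exact (P.wsum_law_relayOut ch fun u o => P.relayRatio ch j u o ^ (-t)).trans_le ht

lemma destMoment_le (j : Fin 3) (ε : ℝ) (hε : 0 < ε) : ∀ᶠ t in nhdsWithin 0 (Set.Ioi 0),
    P.destMoment ch j t ≤ Real.exp (-t * (P.destInfo ch j * Real.log 2 - ε)) := by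
  filter_upwards [wsum_rpow_neg_le (P.isPmf_outLaw ch) (P.destRatio_outLaw_pos ch j) hε]
    with t ht
  rw [wsum_log_destRatio] at ht
  exact (P.wsum_law_destOut ch fun u o => P.destRatio ch j u o ^ (-t)).trans_le ht

end InputDist

end Moments

section RandomCoding

set_option synthInstance.maxSize 1000

lemma isPmf_source (src : SourcePMF (S1 × S2 × W × W3)) : IsPmf src.q :=
  ⟨src.nonneg, src.sum_one⟩

/-- The decoder of the relay, for known previous blocks `a`. -/
def relayDecode (src : SourcePMF (S1 × S2 × W × W3)) (ch : DMMARC X1 X2 X3 Y Y3)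
    (P : InputDist V1 V2 X1 X2 X3) {k l : ℕ} (d : S1 × S2) (θ : ℝ)
    (c : Fin l → Codebook (Fin k → S1) (Fin k → S2) V1 V2 X1 X2 X3)
    (a : (Fin k → S1) × (Fin k → S2)) (o : Fin l → Y3) (w : Fin k → W3) :
    (Fin k → S1) × (Fin k → S2) :=
  jointDecode (fun _ => d.1, fun _ => d.2) θ
    (srcMetric src.q (fun s => s.1) (fun s => s.2.1) fun s => s.2.2.2) (P.relayRatio ch)
    (fun x j => Codebook.letters (c j) a x) o w

/-- The backward decoder of the destination, for known subsequent blocks `b`. -/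
def destDecode (src : SourcePMF (S1 × S2 × W × W3)) (ch : DMMARC X1 X2 X3 Y Y3)
    (P : InputDist V1 V2 X1 X2 X3) {k l : ℕ} (d : S1 × S2) (θ : ℝ)
    (c : Fin l → Codebook (Fin k → S1) (Fin k → S2) V1 V2 X1 X2 X3)
    (b : (Fin k → S1) × (Fin k → S2)) (o : Fin l → Y) (w : Fin k → W) :
    (Fin k → S1) × (Fin k → S2) :=
  jointDecode (fun _ => d.1, fun _ => d.2) θ
    (srcMetric src.q (fun s => s.1) (fun s => s.2.1) fun s => s.2.2.1) (P.destRatio ch)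
    (fun x j => Codebook.letters (c j) x b) o w

variable (src : SourcePMF (S1 × S2 × W × W3)) (ch : DMMARC X1 X2 X3 Y Y3)
  (P : InputDist V1 V2 X1 X2 X3) {m k l B : ℕ} {σ : ℕ → Fin k → Fin m}

lemma wsum_relayDecode_le (d : S1 × S2) {θ : ℝ} (hθ : 0 < θ) {t : Fin 3 → ℝ}
    (ht : ∀ j, 0 < t j) {b : ℕ} (hb : b < B) (hσ : Function.Injective (σ b)) :
    (wsum (piPmf fun _ : Fin l => P.cbLaw) fun c => wsum (piPmf fun _ : Fin m => src.q) fun s =>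
      wsum (piPmf fun j => InputDist.relayOut ch
        (Codebook.letters (c j) (srcPair B σ d s b) (srcPair B σ d s (b + 1)))) fun o =>
        ind (relayDecode src ch P d θ c (srcPair B σ d s b) o (fun i => (s (σ b i)).2.2.2) ≠
          srcPair B σ d s (b + 1))) ≤
    ∑ j, (θ ^ t j * srcMoment src.q (fun s => s.1) (fun s => s.2.1) (fun s => s.2.2.2) j (t j) ^ k *
      P.relayMoment ch j (t j) ^ l + θ⁻¹) := by
  simp only [srcPair_succ σ d _ hb]
  have key := wsum_jointDecode_le
    (μ := (P.cbLaw : Codebook (Fin k → S1) (Fin k → S2) _ _ _ _ _ → ℝ))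
    (n := l) P.isPmf_cbLaw (T := fun a x c => Codebook.letters c a x) (K := InputDist.relayOut ch)
    (InputDist.isPmf_relayOut ch) (pU := P.law) P.wsum_cbLaw_letters (r := P.relayRatio ch)
    (P.relayRatio_nonneg ch) (P.relayRatio_pos ch) (P.wsum_relayRatio_wrong ch) (isPmf_source src)
    (fun s => s.1) (fun s => s.2.1) (fun s => s.2.2.2)
    (srcMetric_nonneg (isPmf_source src) _ _ _) (srcMetric_pos (isPmf_source src) _ _ _)
    (sum_srcMetric_zero_le_one _ _ _ _) (sum_srcMetric_one_le_one _ _ _ _)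
    (sum_srcMetric_two_le_one _ _ _ _) (fun _ => d.1, fun _ => d.2) hσ
    (fun s => srcPair B σ d s b) hθ ht
  exact key

lemma wsum_destDecode_le (d : S1 × S2) {θ : ℝ} (hθ : 0 < θ) {t : Fin 3 → ℝ}
    (ht : ∀ j, 0 < t j) {b : ℕ} (hb : b < B) (hσ : Function.Injective (σ b)) :
    (wsum (piPmf fun _ : Fin l => P.cbLaw) fun c => wsum (piPmf fun _ : Fin m => src.q) fun s =>
      wsum (piPmf fun j => InputDist.destOut ch
        (Codebook.letters (c j) (srcPair B σ d s (b + 1)) (srcPair B σ d s (b + 2)))) fun o =>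
        ind (destDecode src ch P d θ c (srcPair B σ d s (b + 2)) o (fun i => (s (σ b i)).2.2.1) ≠
          srcPair B σ d s (b + 1))) ≤
    ∑ j, (θ ^ t j * srcMoment src.q (fun s => s.1) (fun s => s.2.1) (fun s => s.2.2.1) j (t j) ^ k *
      P.destMoment ch j (t j) ^ l + θ⁻¹) := by
  simp only [srcPair_succ σ d _ hb]
  have key := wsum_jointDecode_le
    (μ := (P.cbLaw : Codebook (Fin k → S1) (Fin k → S2) _ _ _ _ _ → ℝ))
    (n := l) P.isPmf_cbLaw (T := fun b x c => Codebook.letters c x b) (K := InputDist.destOut ch)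
    (InputDist.isPmf_destOut ch) (pU := P.law) (fun b x => P.wsum_cbLaw_letters x b)
    (r := P.destRatio ch) (P.destRatio_nonneg ch) (P.destRatio_pos ch) (P.wsum_destRatio_wrong ch)
    (isPmf_source src) (fun s => s.1) (fun s => s.2.1) (fun s => s.2.2.1)
    (srcMetric_nonneg (isPmf_source src) _ _ _) (srcMetric_pos (isPmf_source src) _ _ _)
    (sum_srcMetric_zero_le_one _ _ _ _) (sum_srcMetric_one_le_one _ _ _ _)
    (sum_srcMetric_two_le_one _ _ _ _) (fun _ => d.1, fun _ => d.2) hσ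
    (fun s => srcPair B σ d s (b + 2)) hθ ht
  exact key

/-- Random coding bound for block Markov superposition codes with backward decoding. -/
theorem exists_code_mabrcErr_le {n : ℕ} (hl : 0 < l) (hn : (B + 1) * l ≤ n)
    (hσ : ∀ i, ∃ b < B, ∃ j, σ b j = i) (hinj : ∀ b < B, Function.Injective (σ b))
    (d : S1 × S2) (y0 : Y) (y30 : Y3) {θ : ℝ} (hθ : 0 < θ) {t3 t : Fin 3 → ℝ} (ht3 : ∀ j, 0 < t3 j)
    (ht : ∀ j, 0 < t j) {R Q : ℝ}
    (hR : ∑ j, (θ ^ t3 j *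
      srcMoment src.q (fun s => s.1) (fun s => s.2.1) (fun s => s.2.2.2) j (t3 j) ^ k *
        P.relayMoment ch j (t3 j) ^ l + θ⁻¹) ≤ R)
    (hQ : ∑ j, (θ ^ t j *
      srcMoment src.q (fun s => s.1) (fun s => s.2.1) (fun s => s.2.2.1) j (t j) ^ k *
        P.destMoment ch j (t j) ^ l + θ⁻¹) ≤ Q) :
    ∃ c : MABRCCode S1 S2 W W3 X1 X2 X3 Y Y3 m n, mabrcErr src ch c ≤ B * R + B * Q := by
  have avg : (wsum (piPmf fun _ : Fin l => P.cbLaw) fun c =>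
      wsum (piPmf fun _ : Fin m => src.q) fun s =>
        (∑ b : Fin B, wsum (piPmf fun j => InputDist.relayOut ch
          (Codebook.letters (c j) (srcPair B σ d s b) (srcPair B σ d s (b + 1)))) fun o =>
          ind (relayDecode src ch P d θ c (srcPair B σ d s b) o (fun i => (s (σ b i)).2.2.2) ≠
            srcPair B σ d s (b + 1))) +
        ∑ b : Fin B, wsum (piPmf fun j => InputDist.destOut ch
          (Codebook.letters (c j) (srcPair B σ d s (b + 1)) (srcPair B σ d s (b + 2)))) fun o =>
          ind (destDecode src ch P d θ c (srcPair B σ d s (b + 2)) o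
            (fun i => (s (σ b i)).2.2.1) ≠ srcPair B σ d s (b + 1))) ≤
      (Finset.univ : Finset (Fin B)).card • R + (Finset.univ : Finset (Fin B)).card • Q := by
    simp only [wsum_add, wsum_sum]
    refine add_le_add
      (Finset.sum_le_card_nsmul _ _ _ fun b _ =>
        (wsum_relayDecode_le src ch P d hθ ht3 b.2 (hinj b b.2)).trans hR)
      (Finset.sum_le_card_nsmul _ _ _ fun b _ =>
        (wsum_destDecode_le src ch P d hθ ht b.2 (hinj b b.2)).trans hQ)
  obtain ⟨c, hc⟩ := exists_le_of_wsum_le (isPmf_piPmf fun _ => P.isPmf_cbLaw) avg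
  obtain ⟨code, hcode⟩ := exists_blockMarkov_code src ch hl hn σ hσ d y0 y30
    (fun a b j => (c j).2.2.1 (a, b)) (fun a b j => (c j).2.2.2.1 (a, b))
    (fun a b j => (c j).2.2.2.2 (a, b)) (relayDecode src ch P d θ c) (destDecode src ch P d θ c)
  refine ⟨code, hcode.trans (hc.trans_eq ?_)⟩
  simp only [Finset.card_univ, Fintype.card_fin, nsmul_eq_mul]

end RandomCoding

/-! ### Choice of the parameters -/

section Parameters

lemma eventually_block_rates {H I κ : ℝ} (h : H < κ * I) :
    ∀ᶠ B : ℕ in Filter.atTop, H * (1 / B) < I * (κ / (B + 1)) := by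
  filter_upwards [tendsto_natCast_atTop_atTop.eventually_gt_atTop (H / (κ * I - H)),
    Filter.eventually_gt_atTop 0] with B hB hB0
  have hB0' : (0 : ℝ) < B := Nat.cast_pos.2 hB0
  rw [div_lt_iff₀ (sub_pos.2 h)] at hB
  rw [mul_one_div, ← mul_div_assoc, div_lt_div_iff₀ hB0' (by positivity)]
  linarith

lemma abs_ceil_div_sub_le_one {m B : ℕ} (hB : 0 < B) :
    |(((m + B - 1) / B : ℕ) : ℝ) - 1 / B * m| ≤ 1 := by
  have h1 : (m + B - 1) / B * B ≤ m + B - 1 := Nat.div_mul_le_self _ _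
  have h2 : m + B - 1 < ((m + B - 1) / B + 1) * B := by
    rw [mul_comm]; exact Nat.lt_mul_div_succ _ hB
  generalize (m + B - 1) / B = k at h1 h2
  have h3 : k * B ≤ m + B := by omega
  have h4 : m ≤ (k + 1) * B := by omega
  have h3' : (k : ℝ) * B ≤ m + B := by exact_mod_cast h3
  have h4' : (m : ℝ) ≤ (k + 1) * B := by exact_mod_cast h4
  have hB' : (0 : ℝ) < B := Nat.cast_pos.2 hB
  rw [abs_sub_le_iff, one_div_mul_eq_div]
  constructor
  · rw [sub_le_iff_le_add, ← div_self hB'.ne', ← add_div, le_div_iff₀ hB']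
    linarith
  · rw [sub_le_iff_le_add, div_le_iff₀ hB']
    linarith

lemma abs_floor_div_sub_le_one {n : ℕ} (B : ℕ) {x : ℝ} (hx : (n : ℝ) = x * (B + 1)) :
    |((n / (B + 1) : ℕ) : ℝ) - x| ≤ 1 := by
  have h1 : n / (B + 1) * (B + 1) ≤ n := Nat.div_mul_le_self _ _
  have h2 : n ≤ (n / (B + 1) + 1) * (B + 1) := by
    rw [mul_comm]; exact (Nat.lt_mul_div_succ _ B.succ_pos).le
  generalize n / (B + 1) = l at h1 h2
  have h1' : (l : ℝ) * (B + 1) ≤ n := by exact_mod_cast h1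
  have h2' : (n : ℝ) ≤ (l + 1) * (B + 1) := by exact_mod_cast h2
  have hB : (0 : ℝ) < B + 1 := by positivity
  rw [hx] at h1' h2'
  have h3 := le_of_mul_le_mul_right h1' hB
  have h4 := le_of_mul_le_mul_right h2' hB
  rw [abs_sub_le_iff]
  constructor <;> linarith

/-- The source positions `1, …, m` are covered by `B` windows of length `⌈m / B⌉`. -/
lemma exists_windows {m B : ℕ} (hB : 0 < B) (hm : 0 < m) :
    ∃ σ : ℕ → Fin ((m + B - 1) / B) → Fin m,
      (∀ i, ∃ b < B, ∃ j, σ b j = i) ∧ ∀ b, Function.Injective (σ b) := by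
  have hk : 0 < (m + B - 1) / B := Nat.div_pos (by omega) hB
  have hkm : (m + B - 1) / B ≤ m := by
    refine Nat.div_le_of_le_mul ?_
    obtain ⟨B, rfl⟩ := Nat.exists_eq_add_of_lt hB
    obtain ⟨m, rfl⟩ := Nat.exists_eq_add_of_lt hm
    nlinarith [Nat.sub_le (0 + m + 1 + (0 + B + 1)) 1, Nat.zero_le (B * m),
      show 0 + m + 1 + (0 + B + 1) - 1 = m + B + 1 by omega]
  have hmk : m ≤ (m + B - 1) / B * B := by
    have := Nat.lt_mul_div_succ (m + B - 1) hB
    rw [mul_add, mul_comm B] at this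
    omega
  generalize (m + B - 1) / B = k at hk hkm hmk
  refine ⟨fun b j => ⟨(b * k + j) % m, Nat.mod_lt _ hm⟩, fun i => ?_, fun b j j' h => ?_⟩
  · refine ⟨i / k, Nat.div_lt_of_lt_mul (i.2.trans_le hmk), ⟨i % k, Nat.mod_lt _ hk⟩, ?_⟩
    ext
    simp only [Nat.div_add_mod', Nat.mod_eq_of_lt i.2]
  · have h' : b * k + j ≡ b * k + j' [MOD m] := Fin.mk.inj_iff.1 h
    exact Fin.ext ((Nat.ModEq.add_left_cancel' _ h').eq_of_lt_of_lt (j.2.trans_le hkm)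
      (j'.2.trans_le hkm))

/-- Joint choice of the Chernoff parameters of the three error events of a receiver. -/
lemma exists_exponents {α β : Fin 3 → ℝ → ℝ} (hα0 : ∀ j t, 0 ≤ α j t) (hβ0 : ∀ j t, 0 ≤ β j t)
    {H I : Fin 3 → ℝ} {u v : ℝ} (hu : 0 < u) (hv : 0 < v) (hlt : ∀ j, H j * u < I j * v)
    (hα : ∀ j, ∀ ε > 0, ∀ᶠ t in nhdsWithin 0 (Set.Ioi 0),
      α j t ≤ Real.exp (t * (H j * Real.log 2 + ε)))
    (hβ : ∀ j, ∀ ε > 0, ∀ᶠ t in nhdsWithin 0 (Set.Ioi 0),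
      β j t ≤ Real.exp (-t * (I j * Real.log 2 - ε))) :
    ∃ t : Fin 3 → ℝ, (∀ j, 0 < t j) ∧ ∀ δ > 0, ∃ m0 : ℕ, ∀ m > m0, ∀ k n : ℕ,
      |(k : ℝ) - u * m| ≤ 1 → |(n : ℝ) - v * m| ≤ 1 →
        ∑ j, ((m : ℝ) ^ t j * α j (t j) ^ k * β j (t j) ^ n + (m : ℝ)⁻¹) ≤ δ := by
  have key := fun j => exists_rpow_mul_pow_mul_pow_small (hα0 j) (hβ0 j) hu hv
    (H := H j * Real.log 2) (I := I j * Real.log 2)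
    (by nlinarith [mul_lt_mul_of_pos_right (hlt j) (Real.log_pos one_lt_two)]) (hα j) (hβ j)
  choose t ht h using key
  refine ⟨t, ht, fun δ hδ => ?_⟩
  choose m0 hm0 using fun j => h j (δ / 6) (by positivity)
  obtain ⟨m1, hm1⟩ := exists_nat_gt (δ / 6)⁻¹
  refine ⟨max m1 (∑ j, m0 j), fun m hm k n hk hn => ?_⟩
  have hinv : (m : ℝ)⁻¹ ≤ δ / 6 := by
    refine inv_le_of_inv_le₀ (by positivity) (hm1.le.trans ?_)
    exact_mod_cast (lt_of_le_of_lt (le_max_left _ _) hm).le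
  calc ∑ j, ((m : ℝ) ^ t j * α j (t j) ^ k * β j (t j) ^ n + (m : ℝ)⁻¹)
      ≤ ∑ _j : Fin 3, (δ / 6 + δ / 6) := Finset.sum_le_sum fun j _ => add_le_add
        (hm0 j m (lt_of_le_of_lt ((Finset.single_le_sum (fun i _ => Nat.zero_le (m0 i))
          (Finset.mem_univ j)).trans (le_max_right _ _)) hm) k n hk hn) hinv
    _ = δ := by simp; ring

end Parameters

section Achievability

lemma IsPmf.nonempty {A : Type*} [Fintype A] {p : A → ℝ} (hp : IsPmf p) : Nonempty A := by
  by_contra h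
  rw [not_nonempty_iff] at h
  simpa using hp.sum_one

theorem mabrcAchievable_of_lt (src : SourcePMF (S1 × S2 × W × W3)) (ch : DMMARC X1 X2 X3 Y Y3)
    (P : InputDist V1 V2 X1 X2 X3) {κ : ℝ} (hκ : 0 < κ)
    (hrelay : ∀ j, srcEnt src.q (fun s => s.1) (fun s => s.2.1) (fun s => s.2.2.2) j <
      κ * P.relayInfo ch j)
    (hdest : ∀ j, srcEnt src.q (fun s => s.1) (fun s => s.2.1) (fun s => s.2.2.1) j <
      κ * P.destInfo ch j) :
    mabrcAchievable src ch κ := by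
  intro ε hε
  have hsrc := isPmf_source src
  obtain ⟨B, ⟨hBr, hBd⟩, hB⟩ :=
    (((Filter.eventually_all.2 fun j => eventually_block_rates (hrelay j)).and
      (Filter.eventually_all.2 fun j => eventually_block_rates (hdest j))).and
      (Filter.eventually_gt_atTop 0)).exists
  have hB' : (0 : ℝ) < B := Nat.cast_pos.2 hB
  have hu : (0 : ℝ) < 1 / B := by positivity
  have hv : 0 < κ / (B + 1) := by positivity
  obtain ⟨t3, ht3, hr⟩ := exists_exponents (srcMoment_nonneg hsrc _ _ _) (P.relayMoment_nonneg ch)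
    hu hv hBr (srcMoment_le hsrc _ _ _) (P.relayMoment_le ch)
  obtain ⟨t, ht, hd⟩ := exists_exponents (srcMoment_nonneg hsrc _ _ _) (P.destMoment_nonneg ch)
    hu hv hBd (srcMoment_le hsrc _ _ _) (P.destMoment_le ch)
  have hδ : 0 < ε / (4 * B) := by positivity
  obtain ⟨mr, hmr⟩ := hr _ hδ
  obtain ⟨md, hmd⟩ := hd _ hδ
  refine ⟨max mr md, B + 1, fun m n hm hn hκn => ?_⟩
  have hm0 : 0 < m := (Nat.zero_le _).trans_lt hm
  have hm0' : (0 : ℝ) < m := Nat.cast_pos.2 hm0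
  obtain ⟨σ, hσ, hinj⟩ := exists_windows hB hm0
  have hk := abs_ceil_div_sub_le_one (m := m) hB
  have hl := abs_floor_div_sub_le_one (n := n) B (x := κ / (B + 1) * m)
    (by rw [← hκn]; field_simp)
  obtain ⟨s0⟩ : Nonempty (S1 × S2 × W × W3) := hsrc.nonempty
  obtain ⟨u0⟩ : Nonempty (V1 × V2 × X1 × X2 × X3 × Y × Y3) := (P.isPmf_outLaw ch).nonempty
  obtain ⟨c, hc⟩ := exists_code_mabrcErr_le src ch P (n := n)
    (Nat.div_pos hn.le B.succ_pos) (Nat.mul_div_le n (B + 1)) hσ (fun b _ => hinj b)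
    (s0.1, s0.2.1) u0.2.2.2.2.2.1 u0.2.2.2.2.2.2 hm0' ht3 ht
    (hmr m ((le_max_left _ _).trans_lt hm) _ _ hk hl)
    (hmd m ((le_max_right _ _).trans_lt hm) _ _ hk hl)
  refine ⟨c, hc.trans_lt ?_⟩
  have : (B : ℝ) * (ε / (4 * B)) + B * (ε / (4 * B)) = ε / 2 := by
    field_simp
    norm_num
  linarith

lemma opSepLaw_eq (src : SourcePMF (S1 × S2 × W × W3)) (ch : DMMARC X1 X2 X3 Y Y3)
    (P : InputDist V1 V2 X1 X2 X3) :
    opSepLaw src ch P.v1 P.x1 P.v2 P.x2 P.x3 = fun z => src.q z.1 * P.outLaw ch z.2 := by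
  funext z
  simp only [opSepLaw, InputDist.outLaw, prodKernel, chan]
  ring

lemma condEnt_fst {Ω Ω' A B : Type*} [Fintype Ω] [Fintype Ω'] [Fintype A] [Fintype B] (q : Ω → ℝ)
    {ν : Ω' → ℝ} (hν : IsPmf ν) (X : Ω → A) (Y : Ω → B) :
    condEnt (fun z : Ω × Ω' => q z.1 * ν z.2) (fun z => X z.1) (fun z => Y z.1) =
      condEnt q X Y := by
  rw [condEnt, condEnt, Hent_fst q hν Y, Hent_fst q hν fun ω => (X ω, Y ω)]

lemma condEnt_snd {Ω Ω' A B : Type*} [Fintype Ω] [Fintype Ω'] [Fintype A] [Fintype B] {q : Ω → ℝ}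
    (hq : IsPmf q) (ν : Ω' → ℝ) (X : Ω' → A) (Y : Ω' → B) :
    condEnt (fun z : Ω × Ω' => q z.1 * ν z.2) (fun z => X z.2) (fun z => Y z.2) =
      condEnt ν X Y := by
  rw [condEnt, condEnt, Hent_snd hq ν Y, Hent_snd hq ν fun ω => (X ω, Y ω)]

lemma condMutInfo_snd {Ω Ω' A B C : Type*} [Fintype Ω] [Fintype Ω'] [Fintype A] [Fintype B]
    [Fintype C] {q : Ω → ℝ} (hq : IsPmf q) (ν : Ω' → ℝ) (X : Ω' → A) (Y : Ω' → B) (Z : Ω' → C) :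
    condMutInfo (fun z : Ω × Ω' => q z.1 * ν z.2) (fun z => X z.2) (fun z => Y z.2)
      (fun z => Z z.2) = condMutInfo ν X Y Z := by
  rw [condMutInfo, condMutInfo, condEnt_snd hq ν X Z, condEnt_snd hq ν X fun ω => (Y ω, Z ω)]

lemma condEnt_lt_of_prod {Ω Ω' A B C D E : Type*} [Fintype Ω] [Fintype Ω'] [Fintype A] [Fintype B]
    [Fintype C] [Fintype D] [Fintype E] {q : Ω → ℝ} {ν : Ω' → ℝ} (hq : IsPmf q) (hν : IsPmf ν)
    (S : Ω → A) (T : Ω → B) (X : Ω' → C) (Y : Ω' → D) (Z : Ω' → E) {κ : ℝ}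
    (h : condEnt (fun z : Ω × Ω' => q z.1 * ν z.2) (fun z => S z.1) (fun z => T z.1) <
      κ * condMutInfo (fun z : Ω × Ω' => q z.1 * ν z.2) (fun z => X z.2) (fun z => Y z.2)
        (fun z => Z z.2)) :
    condEnt q S T < κ * condMutInfo ν X Y Z := by
  rwa [condEnt_fst q hν, condMutInfo_snd hq] at h

end Achievability

/-- **Theorem 1 for the MABRC** (operational separation based achievability). -/
theorem mabrc_operational_separation_achievability
    (src : SourcePMF (S1 × S2 × W × W3)) (ch : DMMARC X1 X2 X3 Y Y3) (κ : ℝ) (hκ : 0 < κ)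
    (pV1 : V1 → ℝ) (pX1 : V1 → X1 → ℝ) (pV2 : V2 → ℝ) (pX2 : V2 → X2 → ℝ)
    (pX3 : V1 → V2 → X3 → ℝ)
    (hpV1 : ∀ v, 0 ≤ pV1 v) (hpV1s : ∑ v, pV1 v = 1)
    (hpV2 : ∀ v, 0 ≤ pV2 v) (hpV2s : ∑ v, pV2 v = 1)
    (hpX1 : ∀ v x, 0 ≤ pX1 v x) (hpX1s : ∀ v, ∑ x, pX1 v x = 1)
    (hpX2 : ∀ v x, 0 ≤ pX2 v x) (hpX2s : ∀ v, ∑ x, pX2 v x = 1)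
    (hpX3 : ∀ v1 v2 x, 0 ≤ pX3 v1 v2 x) (hpX3s : ∀ v1 v2, ∑ x, pX3 v1 v2 x = 1)
    -- H(S1|S2,W3) < κ·I(X1;Y3|X2,V1,X3)
    (h1 : condEnt (opSepLaw src ch pV1 pX1 pV2 pX2 pX3)
        (fun z => z.1.1) (fun z => (z.1.2.1, z.1.2.2.2))
      < κ * condMutInfo (opSepLaw src ch pV1 pX1 pV2 pX2 pX3)
        (fun z => z.2.2.2.1) (fun z => z.2.2.2.2.2.2.2)
        (fun z => (z.2.2.2.2.1, z.2.1, z.2.2.2.2.2.1)))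
    -- H(S2|S1,W3) < κ·I(X2;Y3|X1,V2,X3)
    (h2 : condEnt (opSepLaw src ch pV1 pX1 pV2 pX2 pX3)
        (fun z => z.1.2.1) (fun z => (z.1.1, z.1.2.2.2))
      < κ * condMutInfo (opSepLaw src ch pV1 pX1 pV2 pX2 pX3)
        (fun z => z.2.2.2.2.1) (fun z => z.2.2.2.2.2.2.2)
        (fun z => (z.2.2.2.1, z.2.2.1, z.2.2.2.2.2.1)))
    -- H(S1,S2|W3) < κ·I(X1,X2;Y3|V1,V2,X3)
    (h3 : condEnt (opSepLaw src ch pV1 pX1 pV2 pX2 pX3)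
        (fun z => (z.1.1, z.1.2.1)) (fun z => z.1.2.2.2)
      < κ * condMutInfo (opSepLaw src ch pV1 pX1 pV2 pX2 pX3)
        (fun z => (z.2.2.2.1, z.2.2.2.2.1)) (fun z => z.2.2.2.2.2.2.2)
        (fun z => (z.2.1, z.2.2.1, z.2.2.2.2.2.1)))
    -- H(S1|S2,W) < κ·I(X1,X3;Y|X2,V2)
    (h4 : condEnt (opSepLaw src ch pV1 pX1 pV2 pX2 pX3)
        (fun z => z.1.1) (fun z => (z.1.2.1, z.1.2.2.1))
      < κ * condMutInfo (opSepLaw src ch pV1 pX1 pV2 pX2 pX3)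
        (fun z => (z.2.2.2.1, z.2.2.2.2.2.1)) (fun z => z.2.2.2.2.2.2.1)
        (fun z => (z.2.2.2.2.1, z.2.2.1)))
    -- H(S2|S1,W) < κ·I(X2,X3;Y|X1,V1)
    (h5 : condEnt (opSepLaw src ch pV1 pX1 pV2 pX2 pX3)
        (fun z => z.1.2.1) (fun z => (z.1.1, z.1.2.2.1))
      < κ * condMutInfo (opSepLaw src ch pV1 pX1 pV2 pX2 pX3)
        (fun z => (z.2.2.2.2.1, z.2.2.2.2.2.1)) (fun z => z.2.2.2.2.2.2.1)
        (fun z => (z.2.2.2.1, z.2.1)))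
    -- H(S1,S2|W) < κ·I(X1,X2,X3;Y)
    (h6 : condEnt (opSepLaw src ch pV1 pX1 pV2 pX2 pX3)
        (fun z => (z.1.1, z.1.2.1)) (fun z => z.1.2.2.1)
      < κ * mutInfo (opSepLaw src ch pV1 pX1 pV2 pX2 pX3)
        (fun z => (z.2.2.2.1, z.2.2.2.2.1, z.2.2.2.2.2.1)) (fun z => z.2.2.2.2.2.2.1)) :
    mabrcAchievable src ch κ := by
  have hq := isPmf_source src
  let P : InputDist V1 V2 X1 X2 X3 :=
    { v1 := pV1, v2 := pV2, x1 := pX1, x2 := pX2, x3 := pX3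
      isPmf_v1 := ⟨hpV1, hpV1s⟩
      isPmf_v2 := ⟨hpV2, hpV2s⟩
      isPmf_x1 := fun v => ⟨hpX1 v, hpX1s v⟩
      isPmf_x2 := fun v => ⟨hpX2 v, hpX2s v⟩
      isPmf_x3 := fun v1 v2 => ⟨hpX3 v1 v2, hpX3s v1 v2⟩ }
  have hlaw : opSepLaw src ch pV1 pX1 pV2 pX2 pX3 = fun z => src.q z.1 * P.outLaw ch z.2 :=
    opSepLaw_eq src ch P
  have hν := P.isPmf_outLaw ch
  have hμ : IsPmf fun z : (S1 × S2 × W × W3) × V1 × V2 × X1 × X2 × X3 × Y × Y3 =>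
      src.q z.1 * P.outLaw ch z.2 := isPmf_prodKernel hq fun _ => hν
  rw [hlaw] at h1 h2 h3 h4 h5 h6
  rw [mutInfo_eq_condMutInfo hμ] at h6
  have r1 := condEnt_lt_of_prod hq hν (fun s => s.1) (fun s => (s.2.1, s.2.2.2))
    (fun z => z.2.2.1) (fun z => z.2.2.2.2.2.2) (fun z => (z.2.2.2.1, z.1, z.2.2.2.2.1)) h1
  have r2 := condEnt_lt_of_prod hq hν (fun s => s.2.1) (fun s => (s.1, s.2.2.2))
    (fun z => z.2.2.2.1) (fun z => z.2.2.2.2.2.2) (fun z => (z.2.2.1, z.2.1, z.2.2.2.2.1)) h2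
  have r3 := condEnt_lt_of_prod hq hν (fun s => (s.1, s.2.1)) (fun s => s.2.2.2)
    (fun z => (z.2.2.1, z.2.2.2.1)) (fun z => z.2.2.2.2.2.2)
    (fun z => (z.1, z.2.1, z.2.2.2.2.1)) h3
  have d1 := condEnt_lt_of_prod hq hν (fun s => s.1) (fun s => (s.2.1, s.2.2.1))
    (fun z => (z.2.2.1, z.2.2.2.2.1)) (fun z => z.2.2.2.2.2.1) (fun z => (z.2.2.2.1, z.2.1)) h4
  have d2 := condEnt_lt_of_prod hq hν (fun s => s.2.1) (fun s => (s.1, s.2.2.1))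
    (fun z => (z.2.2.2.1, z.2.2.2.2.1)) (fun z => z.2.2.2.2.2.1) (fun z => (z.2.2.1, z.1)) h5
  have d3 := condEnt_lt_of_prod hq hν (fun s => (s.1, s.2.1)) (fun s => s.2.2.1)
    (fun z => (z.2.2.1, z.2.2.2.1, z.2.2.2.2.1)) (fun z => z.2.2.2.2.2.1) (fun _ => ()) h6
  exact mabrcAchievable_of_lt src ch P hκ
    (Fin.forall_fin_succ.2 ⟨r1, Fin.forall_fin_two.2 ⟨r2, r3⟩⟩)
    (Fin.forall_fin_succ.2 ⟨d1, Fin.forall_fin_two.2 ⟨d2, d3⟩⟩)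

end OperationalSeparation

end Paper
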